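/- Finite-memory SAS winning reduces to a non-stochastic game with a conjunction of two parity conditions: let G be a finite SAS parity game with n configurations, sure priority function p_s of index d_s and almost-sure priority function p_as of index d_as, and let G' be the two-player non-stochastic game obtained from G by replacing each probabilistic configuration by the gadget described below. Then G' has O(n · d_as) configurations, its winning condition for Player 0 is the intersection of the two parity conditions induced by p'_s and p'_as, and for every configuration v ∈ V0 ∪ V1, Player 0 has a finite-memory winning strategy from v in G iff Player 0 has a sure winning strategy from v in G'; moreover for every v ∈ Vp, Player 0 has a finite-memory winning strategy from v in G iff Player 0 has a sure winning strategy from v̄ in G'. -/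

import Mathlib

open MeasureTheory

/-- The set of elements occurring infinitely often in an infinite sequence. -/
def InfOcc {α : Type*} (s : ℕ → α) : Set α := {v | ∀ n, ∃ m, n ≤ m ∧ s m = v}

/-- The minimal priority occurring infinitely often. -/
noncomputable def minPrio {α : Type*} (p : α → ℕ) (s : ℕ → α) : ℕ := sInf (p '' InfOcc s)

/-- The parity condition induced by a priority function. -/
def ParityWin {α : Type*} (p : α → ℕ) : Set (ℕ → α) := {s | Even (minPrio p s)}

/-- The history of a play up to (excluding) time `n`. -/
def hist {α : Type*} (p : ℕ → α) (n : ℕ) : List α := (List.range n).map p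

/-- A finite stochastic game graph together with two priority functions:
`ps` inducing the sure parity condition and `pas` inducing the almost-sure one. -/
structure SASGame (V : Type) [Fintype V] where
  V0 : Set V
  V1 : Set V
  Vp : Set V
  cover : V0 ∪ V1 ∪ Vp = Set.univ
  disj01 : Disjoint V0 V1
  disj0p : Disjoint V0 Vp
  disj1p : Disjoint V1 Vp
  E : V → V → Prop
  succ_nonempty : ∀ v, ∃ w, E v w
  κ : V → V → ENNReal
  κ_pos : ∀ v ∈ Vp, ∀ w, (0 < κ v w ↔ E v w)
  κ_sum : ∀ v ∈ Vp, ∑ w, κ v w = 1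
  ps : V → ℕ
  pas : V → ℕ

variable {V : Type} [Fintype V]

/-- A strategy: given the past history and the current configuration, choose a successor. -/
abbrev Strat (V : Type) := List V → V → V

/-- A valid Player-0 strategy respects the edge relation on Player-0 configurations. -/
def SASGame.Valid0 (G : SASGame V) (σ : Strat V) : Prop := ∀ h v, v ∈ G.V0 → G.E v (σ h v)

/-- A valid Player-1 strategy respects the edge relation on Player-1 configurations. -/
def SASGame.Valid1 (G : SASGame V) (π : Strat V) : Prop := ∀ h v, v ∈ G.V1 → G.E v (π h v)

/-- A strategy is memoryless if it only depends on the current configuration. -/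
def Memoryless {V : Type} (σ : Strat V) : Prop := ∀ h h' v, σ h v = σ h' v

/-- `v(σ)`: the plays from `v` consistent with the Player-0 strategy `σ`. -/
def SASGame.PlaysFrom (G : SASGame V) (v : V) (σ : Strat V) : Set (ℕ → V) :=
  {p | p 0 = v ∧ (∀ n, G.E (p n) (p (n + 1))) ∧
    ∀ n, p n ∈ G.V0 → p (n + 1) = σ (hist p n) (p n)}

/-- The plays from `v` consistent with both strategies `σ` and `π`. -/
def SASGame.Plays2 (G : SASGame V) (v : V) (σ π : Strat V) : Set (ℕ → V) :=
  {p | p ∈ G.PlaysFrom v σ ∧ ∀ n, p n ∈ G.V1 → p (n + 1) = π (hist p n) (p n)}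

open Classical in
/-- One-step transition probability of the Markov chain `v(σ,π)`. -/
noncomputable def SASGame.step (G : SASGame V) (σ π : Strat V)
    (past : List V) (cur nxt : V) : ENNReal :=
  if cur ∈ G.V0 then (if nxt = σ past cur then 1 else 0)
  else if cur ∈ G.V1 then (if nxt = π past cur then 1 else 0)
  else G.κ cur nxt

open Classical in
/-- Probability of the cylinder determined by the first `n+1` configurations of `h`. -/
noncomputable def SASGame.cylProb (G : SASGame V) (v : V) (σ π : Strat V)
    (h : ℕ → V) (n : ℕ) : ENNReal :=
  (if h 0 = v then 1 else 0) * ∏ i ∈ Finset.range n, G.step σ π (hist h i) (h i) (h (i + 1))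

/-- The product σ-algebra on plays. -/
def playMS (V : Type) : MeasurableSpace (ℕ → V) :=
  @MeasurableSpace.pi ℕ (fun _ => V) (fun _ => ⊤)

/-- `μ` is the probability measure of the Markov chain `v(σ,π)`: it is the (unique)
probability measure on plays assigning to every cylinder the product of the
transition probabilities along it. -/
def SASGame.IsPlayMeasure (G : SASGame V) (v : V) (σ π : Strat V)
    (μ : @Measure (ℕ → V) (playMS V)) : Prop :=
  μ Set.univ = 1 ∧
    ∀ (h : ℕ → V) (n : ℕ), μ {p | ∀ i ≤ n, p i = h i} = G.cylProb v σ π h n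

/-- Player 0 wins from `v` with strategy `σ`. -/
def SASGame.Wins0Via (G : SASGame V) (v : V) (σ : Strat V) : Prop :=
  G.Valid0 σ ∧ G.PlaysFrom v σ ⊆ ParityWin G.ps ∧
    ∀ π, G.Valid1 π → ∀ μ, G.IsPlayMeasure v σ π μ → μ (ParityWin G.pas) = 1

/-- Player 0 wins from `v`: she has a strategy `σ` such that all plays consistent with
`σ` satisfy the sure parity condition and, against every Player-1 strategy, the
almost-sure parity condition holds with probability 1. -/
def SASGame.Wins0 (G : SASGame V) (v : V) : Prop := ∃ σ, G.Wins0Via v σ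

/-- Player 1 wins from `v` with strategy `π`. -/
def SASGame.Wins1Via (G : SASGame V) (v : V) (π : Strat V) : Prop :=
  G.Valid1 π ∧ ∀ σ, G.Valid0 σ →
    (∃ p ∈ G.Plays2 v σ π, p ∉ ParityWin G.ps) ∨
    (∀ μ, G.IsPlayMeasure v σ π μ → μ (ParityWin G.pas) < 1)

/-- Player 1 wins from `v`. -/
def SASGame.Wins1 (G : SASGame V) (v : V) : Prop := ∃ π, G.Wins1Via v π

/-! ### The reduced two-player game `G'` obtained by replacing probabilistic
configurations by gadgets. -/

/-- Configurations of the reduced game: original configurations `base v`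
(for `v ∈ V0 ∪ V1`), and for each probabilistic `v` the gadget configurations
`bar v` (= v̄), `tilde v k` (= (ṽ,k) for even `k`) and `hat v j` (= (v̂,j)). -/
inductive GVert (V : Type) where
  | base : V → GVert V
  | bar : V → GVert V
  | tilde : V → ℕ → GVert V
  | hat : V → ℕ → GVert V
deriving DecidableEq

open Classical in
/-- A successor `w` of `G` is represented in `G'` by `bar w` if `w` is
probabilistic and by `base w` otherwise. -/
noncomputable def GLift (G : SASGame V) (w : V) : GVert V :=
  if w ∈ G.Vp then GVert.bar w else GVert.base w

/-- The configuration of `G` a configuration of `G'` belongs to. -/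
def GVert.unlift {V : Type} : GVert V → V
  | .base v => v
  | .bar v => v
  | .tilde v _ => v
  | .hat v _ => v

/-- The configurations of the reduced game `G'`. -/
def GValid (G : SASGame V) : GVert V → Prop
  | .base v => v ∈ G.V0 ∪ G.V1
  | .bar v => v ∈ G.Vp
  | .tilde v k => v ∈ G.Vp ∧ Even k ∧ k ≤ G.pas v + 1
  | .hat v j => v ∈ G.Vp ∧ j ≤ G.pas v

/-- The edge relation of the reduced game `G'`: edges among `V0 ∪ V1` remain
(redirected to `bar w` when `w ∈ Vp`), `bar v` moves to the `tilde v k`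
(even `k ∈ [0..pas v + 1]`), `tilde v k` moves to `hat v k` (when `k ≤ pas v`)
or to `hat v (k-1)` (when `k - 1 ≥ 1`), and `hat v j` moves to the successors
of `v` in `G`. -/
def GEdge (G : SASGame V) : GVert V → GVert V → Prop
  | .base v, y => (v ∈ G.V0 ∪ G.V1) ∧ ∃ w, G.E v w ∧ y = GLift G w
  | .bar v, y => v ∈ G.Vp ∧ ∃ k, Even k ∧ k ≤ G.pas v + 1 ∧ y = GVert.tilde v k
  | .tilde v k, y => v ∈ G.Vp ∧ Even k ∧ k ≤ G.pas v + 1 ∧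
      ((y = GVert.hat v k ∧ k ≤ G.pas v) ∨ (y = GVert.hat v (k - 1) ∧ 1 ≤ k - 1))
  | .hat v j, y => v ∈ G.Vp ∧ j ≤ G.pas v ∧ ∃ w, G.E v w ∧ y = GLift G w

/-- Player-0 configurations of the reduced game `G'`: `base v` with `v ∈ V0`,
all `tilde` configurations, and `hat v j` for odd `j`. -/
def GP0 (G : SASGame V) : GVert V → Prop
  | .base v => v ∈ G.V0
  | .bar _ => False
  | .tilde _ _ => True
  | .hat _ j => Odd j

/-- The almost-sure priority function `p'_as` of `G'`. -/
def GPas (G : SASGame V) : GVert V → ℕ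
  | .base v => G.pas v
  | .bar v => G.pas v
  | .tilde v _ => G.pas v
  | .hat _ j => j

/-- The sure priority function `p'_s` of `G'`. -/
def GPs (G : SASGame V) : GVert V → ℕ
  | .base v => G.ps v
  | .bar v => G.ps v
  | .tilde v _ => G.ps v
  | .hat v _ => G.ps v

/-- Player 0 sure-wins the two-player game `G'` from `x` for the winning
condition given by the intersection of the two parity conditions induced by
`p'_s` and `p'_as`. -/
def GSureWin (G : SASGame V) (x : GVert V) : Prop :=
  ∃ σ' : List (GVert V) → GVert V → GVert V,
    (∀ h y, GP0 G y → (∃ z, GEdge G y z) → GEdge G y (σ' h y)) ∧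
    ∀ p : ℕ → GVert V, p 0 = x → (∀ n, GEdge G (p n) (p (n + 1))) →
      (∀ n, GP0 G (p n) → p (n + 1) = σ' (hist p n) (p n)) →
      p ∈ ParityWin (GPs G) ∧ p ∈ ParityWin (GPas G)

/-- A strategy has finite memory if it is computed by a finite-state transducer
over histories. -/
def FiniteMemory {V : Type} (σ : Strat V) : Prop :=
  ∃ (M : Type) (_ : Fintype M) (m0 : M) (upd : M → V → M) (out : M → V → V),
    ∀ h v, σ h v = out (h.foldl upd m0) v

/-- Player 0 wins the SAS game from `v` with a finite-memory strategy. -/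
def SASGame.FinWins0 (G : SASGame V) (v : V) : Prop :=
  ∃ σ, FiniteMemory σ ∧ G.Wins0Via v σ

/-- `q` is the least value taken infinitely often by `e`, and `e` is eventually at least `q`. -/
def IsMinInf (e : ℕ → ℕ) (q : ℕ) : Prop :=
  (∀ N, ∃ n, N ≤ n ∧ e n = q) ∧ ∃ N, ∀ n, N ≤ n → q ≤ e n

/-- The least value taken infinitely often by `e` is even. -/
def EvenInf (e : ℕ → ℕ) : Prop := ∀ q, IsMinInf e q → Even q

theorem IsMinInf.unique {e : ℕ → ℕ} {q q' : ℕ} (h : IsMinInf e q) (h' : IsMinInf e q') :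
    q = q' := by
  obtain ⟨h1, N, hN⟩ := h
  obtain ⟨h1', N', hN'⟩ := h'
  obtain ⟨n, hn, rfl⟩ := h1 N'
  obtain ⟨m, hm, rfl⟩ := h1' N
  exact le_antisymm (hN _ hm) (hN' _ hn)

theorem exists_isMinInf {e : ℕ → ℕ} {B : ℕ} (hB : ∀ n, e n ≤ B) : ∃ q, IsMinInf e q := by
  classical
  let P : ℕ → Prop := fun q => ∃ N, ∀ n, N ≤ n → q ≤ e n
  have h0 : P 0 := ⟨0, fun _ _ => Nat.zero_le _⟩
  obtain ⟨N, hN⟩ : P (Nat.findGreatest P B) := Nat.findGreatest_spec (Nat.zero_le B) h0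
  refine ⟨Nat.findGreatest P B, ?_, N, hN⟩
  intro M
  by_contra! hcon
  have hP : P (Nat.findGreatest P B + 1) :=
    ⟨max M N, fun n hn => lt_of_le_of_ne (hN n (le_trans (le_max_right _ _) hn))
      (hcon n (le_trans (le_max_left _ _) hn)).symm⟩
  have hle : Nat.findGreatest P B + 1 ≤ B := by
    obtain ⟨K, hK⟩ := hP
    exact (hK K le_rfl).trans (hB K)
  have := Nat.le_findGreatest hle hP
  omega

theorem IsMinInf.shift {e : ℕ → ℕ} {q : ℕ} (h : IsMinInf e q) (k : ℕ) :
    IsMinInf (fun n => e (n + k)) q := by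
  obtain ⟨h1, N, hN⟩ := h
  refine ⟨fun M => ?_, N, fun n hn => hN _ (by omega)⟩
  obtain ⟨n, hn, hq⟩ := h1 (M + k)
  exact ⟨n - k, by omega, by simpa [Nat.sub_add_cancel (show k ≤ n by omega)] using hq⟩

theorem EvenInf.of_shift {e : ℕ → ℕ} (k : ℕ) (h : EvenInf fun n => e (n + k)) : EvenInf e :=
  fun q hq => h q (hq.shift k)

theorem EvenInf.shift {e : ℕ → ℕ} (h : EvenInf e) (k : ℕ) : EvenInf fun n => e (n + k) := by
  intro q hq
  obtain ⟨h1, N, hN⟩ := hq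
  refine h q ⟨fun M => ?_, N + k, fun n hn => ?_⟩
  · obtain ⟨n, hn, e⟩ := h1 M
    exact ⟨n + k, by omega, e⟩
  · have := hN (n - k) (by omega)
    simpa only [Nat.sub_add_cancel (show k ≤ n by omega)] using this

/-- Pigeonhole principle for infinitely many times. -/
theorem exists_frequently_eq {S : Type*} {f : ℕ → S} (hf : (Set.range f).Finite) {P : ℕ → Prop}
    (hP : ∀ N, ∃ n, N ≤ n ∧ P n) : ∃ x, ∀ N, ∃ n, N ≤ n ∧ P n ∧ f n = x := by
  by_contra! hcon
  have h1 : ∀ x ∈ Set.range f, ∀ᶠ n in Filter.atTop, P n → f n ≠ x := fun x _ =>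
    let ⟨N, hN⟩ := hcon x
    Filter.eventually_atTop.2 ⟨N, fun n hn hPn => hN n hn hPn⟩
  obtain ⟨N, hN⟩ := Filter.eventually_atTop.1 ((Filter.eventually_all_finite hf).2 h1)
  obtain ⟨n, hn, hPn⟩ := hP N
  exact hN n hn _ ⟨n, rfl⟩ hPn rfl

theorem mem_parityWin_iff {α : Type*} {p : α → ℕ} {s : ℕ → α} (hs : (Set.range s).Finite) :
    s ∈ ParityWin p ↔ EvenInf fun n => p (s n) := by
  obtain ⟨B, hB⟩ : ∃ B, ∀ n, p (s n) ≤ B := by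
    obtain ⟨B, hB⟩ := (hs.image p).bddAbove
    exact ⟨B, fun n => hB ⟨_, ⟨n, rfl⟩, rfl⟩⟩
  obtain ⟨q, hq⟩ := exists_isMinInf hB
  have hmin : minPrio p s = q := by
    obtain ⟨x, hx⟩ := exists_frequently_eq hs hq.1
    obtain ⟨N, hN⟩ := hq.2
    apply le_antisymm
    · refine Nat.sInf_le ⟨x, fun n => ?_, ?_⟩
      · obtain ⟨m, hm, -, h⟩ := hx n
        exact ⟨m, hm, h⟩
      · obtain ⟨m, -, h, rfl⟩ := hx 0
        exact h
    · refine le_csInf ⟨p x, x, fun n => ?_, rfl⟩ ?_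
      · obtain ⟨m, hm, -, h⟩ := hx n
        exact ⟨m, hm, h⟩
      · rintro _ ⟨y, hy, rfl⟩
        obtain ⟨m, hm, rfl⟩ := hy N
        exact hN m hm
  change Even (minPrio p s) ↔ _
  rw [hmin]
  exact ⟨fun h q' hq' => hq.unique hq' ▸ h, fun h => h q hq⟩

/-- Attractor of `T` inside a finite arena `A`, with a rank witnessing progress towards `T`. -/
theorem exists_attractor {X : Type*} (E : X → X → Prop) (P0 : X → Prop) {A T : Set X}
    (hA : A.Finite) (hT : T ⊆ A) :
    ∃ (B : Set X) (r : X → ℕ), T ⊆ B ∧ B ⊆ A ∧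
      (∀ x ∈ B, x ∉ T → P0 x → ∃ y ∈ B, E x y ∧ r y < r x) ∧
      (∀ x ∈ B, x ∉ T → ¬ P0 x → ∀ y ∈ A, E x y → y ∈ B ∧ r y < r x) ∧
      (∀ x ∈ A, x ∉ B → P0 x → ∀ y ∈ B, ¬ E x y) ∧
      (∀ x ∈ A, x ∉ B → ¬ P0 x → ∃ y ∈ A, y ∉ B ∧ E x y) := by
  classical
  let F : Set (Set X) := {B | B ⊆ A ∧ T ⊆ B ∧ ∃ r : X → ℕ,
      (∀ x ∈ B, x ∉ T → P0 x → ∃ y ∈ B, E x y ∧ r y < r x) ∧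
      (∀ x ∈ B, x ∉ T → ¬ P0 x → ∀ y ∈ A, E x y → y ∈ B ∧ r y < r x)}
  have hF : F.Finite := hA.finite_subsets.subset fun B hB => hB.1
  have hTF : T ∈ F := ⟨hT, subset_rfl, fun _ => 0, fun x h h' => (h' h).elim,
    fun x h h' => (h' h).elim⟩
  obtain ⟨B, -, ⟨hBA, hTB, r, h0, h1⟩, hmax⟩ := hF.exists_le_maximal hTF
  obtain ⟨b, hb⟩ : ∃ b, ∀ y ∈ B, r y < b := by
    obtain ⟨b, hb⟩ := ((hA.subset hBA).image r).bddAbove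
    exact ⟨b + 1, fun y hy => Nat.lt_succ_of_le (hb ⟨y, hy, rfl⟩)⟩
  have key : ∀ x ∈ A, x ∉ B → (P0 x → ∃ y ∈ B, E x y) →
      (¬ P0 x → ∀ y ∈ A, E x y → y ∈ B) → False := by
    intro x hxA hxB hx0 hx1
    have hne : ∀ y ∈ B, y ≠ x := fun y hy h => hxB (h ▸ hy)
    have hr : ∀ y ∈ B, Function.update r x b y = r y := fun y hy =>
      Function.update_of_ne (hne y hy) _ _
    refine hxB (hmax (y := insert x B) ⟨Set.insert_subset hxA hBA,
      hTB.trans (Set.subset_insert _ _), Function.update r x b, ?_, ?_⟩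
      (Set.subset_insert _ _) (Set.mem_insert _ _))
    · rintro z (rfl | hz) hzT hz0
      · obtain ⟨y, hy, hE⟩ := hx0 hz0
        exact ⟨y, Or.inr hy, hE, by rw [hr y hy, Function.update_self]; exact hb y hy⟩
      · obtain ⟨y, hy, hE, hlt⟩ := h0 z hz hzT hz0
        exact ⟨y, Or.inr hy, hE, by rwa [hr y hy, hr z hz]⟩
    · rintro z (rfl | hz) hzT hz0 y hyA hE
      · have hy := hx1 hz0 y hyA hE
        exact ⟨Or.inr hy, by rw [hr y hy, Function.update_self]; exact hb y hy⟩
      · obtain ⟨hy, hlt⟩ := h1 z hz hzT hz0 y hyA hE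
        exact ⟨Or.inr hy, by rwa [hr y hy, hr z hz]⟩
  refine ⟨B, r, hTB, hBA, h0, h1, ?_, ?_⟩
  · intro x hxA hxB hx y hy hE
    exact key x hxA hxB (fun _ => ⟨y, hy, hE⟩) (fun h => (h hx).elim)
  · intro x hxA hxB hx
    by_contra! hcon
    exact key x hxA hxB (fun h => (hx h).elim) fun _ y hy hE => by
      by_contra hyB
      exact hcon y hy hyB hE

/-- A strategy for Player 0, given as a graph `R` of memory states labelled by positions:
the positions occurring are those of `A`, all moves of Player 1 inside `A` are answered, and along
every infinite path both parity conditions hold. -/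
structure Tableau {X : Type} (E : X → X → Prop) (P0 : X → Prop) (p : Bool → X → ℕ) (A : Set X)
    {S : Type} (l : S → X) (R : S → S → Prop) : Prop where
  mem : ∀ s, l s ∈ A
  surj : ∀ x ∈ A, ∃ s, l s = x
  edge : ∀ s s', R s s' → E (l s) (l s')
  succ : ∀ s, ∃ s', R s s'
  opp : ∀ s, ¬ P0 (l s) → ∀ y ∈ A, E (l s) y → ∃ s', R s s' ∧ l s' = y
  win : ∀ f : ℕ → S, (∀ n, R (f n) (f (n + 1))) → ∀ i, EvenInf fun n => p i (l (f n))

namespace Tableau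

variable {X : Type} {E : X → X → Prop} {P0 : X → Prop} {p : Bool → X → ℕ} {A : Set X}
  {S : Type} {l : S → X} {R : S → S → Prop}

theorem restrict (h : Tableau E P0 p A l R) (C : Set S) {A' : Set X} (hA' : A' ⊆ A)
    (hCA : ∀ s ∈ C, l s ∈ A') (hAC : ∀ x ∈ A', ∃ s ∈ C, l s = x)
    (hs : ∀ s ∈ C, ∃ s' ∈ C, R s s')
    (ho : ∀ s ∈ C, ∀ s', R s s' → l s' ∈ A' → s' ∈ C) :
    Tableau E P0 p A' (fun s : C => l s) (fun s s' => R s s') where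
  mem s := hCA s s.2
  surj x hx := let ⟨s, hs, e⟩ := hAC x hx; ⟨⟨s, hs⟩, e⟩
  edge s s' hR := h.edge _ _ hR
  succ s := let ⟨s', hs', hR⟩ := hs s s.2; ⟨⟨s', hs'⟩, hR⟩
  opp s h0 y hy hE := by
    obtain ⟨s', hR, rfl⟩ := h.opp s h0 y (hA' hy) hE
    exact ⟨⟨s', ho s s.2 s' hR hy⟩, hR, rfl⟩
  win f hf i := h.win (fun n => (f n : S)) hf i

/-- Restriction of a tableau to a set of positions that Player 0 cannot leave. -/
theorem restrict_trap (h : Tableau E P0 p A l R) {B : Set X}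
    (h0 : ∀ x ∈ A, x ∉ B → P0 x → ∀ y ∈ B, ¬ E x y)
    (h1 : ∀ x ∈ A, x ∉ B → ¬ P0 x → ∃ y ∈ A, y ∉ B ∧ E x y) :
    Tableau E P0 p (A \ B) (fun s : {s | l s ∉ B} => l s) (fun s s' => R s s') := by
  refine h.restrict _ Set.sdiff_subset (fun s hs => ⟨h.mem s, hs⟩) ?_ ?_ fun s hs s' hR hs' => hs'.2
  · rintro x ⟨hx, hxB⟩
    obtain ⟨s, rfl⟩ := h.surj x hx
    exact ⟨s, hxB, rfl⟩
  · intro s hs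
    by_cases hP : P0 (l s)
    · obtain ⟨s', hR⟩ := h.succ s
      exact ⟨s', fun hB => h0 _ (h.mem s) hs hP _ hB (h.edge _ _ hR), hR⟩
    · obtain ⟨y, hy, hyB, hE⟩ := h1 _ (h.mem s) hs hP
      obtain ⟨s', hR, rfl⟩ := h.opp s hP y hy hE
      exact ⟨s', hyB, hR⟩

theorem exists_edge (h : Tableau E P0 p A l R) {x : X} (hx : x ∈ A) : ∃ y ∈ A, E x y := by
  obtain ⟨s, rfl⟩ := h.surj x hx
  obtain ⟨s', hR⟩ := h.succ s
  exact ⟨_, h.mem s', h.edge _ _ hR⟩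

end Tableau

/-- `Reach R P n s`: an `R`-path of length `n` leads from `s` to a state satisfying `P`. -/
def Reach {S : Type*} (R : S → S → Prop) (P : S → Prop) : ℕ → S → Prop
  | 0, s => P s
  | n + 1, s => ∃ s', R s s' ∧ Reach R P n s'

/-- If `P` stays reachable, some infinite path satisfies `P` infinitely often. -/
theorem exists_path_frequently {S : Type*} {R : S → S → Prop} {P : S → Prop}
    (hR : ∀ s, ∃ s', R s s') (h : ∀ s, ∃ n, Reach R P n s) (s : S) :
    ∃ f : ℕ → S, (∀ n, R (f n) (f (n + 1))) ∧ ∀ N, ∃ n, N ≤ n ∧ P (f n) := by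
  classical
  have hstep : ∀ s, ∃ s', R s s' ∧ (P s ∨ Nat.find (h s') < Nat.find (h s)) := by
    intro s
    by_cases hP : P s
    · obtain ⟨s', hs'⟩ := hR s
      exact ⟨s', hs', Or.inl hP⟩
    · have h1 := Nat.find_spec (h s)
      cases hn : Nat.find (h s) with
      | zero =>
        rw [hn] at h1
        exact (hP h1).elim
      | succ k =>
        rw [hn] at h1
        obtain ⟨s', hs', hk⟩ := h1
        exact ⟨s', hs', Or.inr (Nat.lt_succ_of_le (Nat.find_min' _ hk))⟩
  choose g hg1 hg2 using hstep
  refine ⟨fun n => g^[n] s, fun n => ?_, fun N => ?_⟩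
  · simp only [Function.iterate_succ_apply']
    exact hg1 _
  · have : ∀ d N, Nat.find (h (g^[N] s)) ≤ d → ∃ n, N ≤ n ∧ P (g^[n] s) := by
      intro d
      induction d with
      | zero =>
        intro N hN
        rcases hg2 (g^[N] s) with hP | hlt
        · exact ⟨N, le_rfl, hP⟩
        · omega
      | succ d ih =>
        intro N hN
        rcases hg2 (g^[N] s) with hP | hlt
        · exact ⟨N, le_rfl, hP⟩
        · obtain ⟨n, hn, hP⟩ := ih (N + 1) (by
            rw [Function.iterate_succ_apply']; omega)
          exact ⟨n, by omega, hP⟩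
    exact this _ N le_rfl

section Alternate

variable {X : Type} (E : X → X → Prop) (T B : Bool → Set X) (r : Bool → X → ℕ)
  {S : Bool → Type} (l : ∀ i, S i → X) (R : ∀ i, S i → S i → Prop)

/-- The label of a memory state of the alternating strategy. -/
def altLabel : (Σ i, B i ⊕ S i) → X
  | ⟨_, Sum.inl x⟩ => x
  | ⟨i, Sum.inr s⟩ => l i s

/-- The strategy that, in mode `i`, attracts to the target `T i` from the attractor `B i`, plays a
given strategy outside of `B i`, and changes the mode when the target is reached. -/
inductive AltStep : (Σ i, B i ⊕ S i) → (Σ i, B i ⊕ S i) → Prop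
  | switch (i : Bool) (x : B i) (b : Σ i, B i ⊕ S i) : (x : X) ∈ T i → b.1 = !i →
      E x (altLabel B l b) → AltStep ⟨i, Sum.inl x⟩ b
  | attract (i : Bool) (x y : B i) : (x : X) ∉ T i → r i y < r i x → E x y →
      AltStep ⟨i, Sum.inl x⟩ ⟨i, Sum.inl y⟩
  | stay (i : Bool) (s s' : S i) : R i s s' → AltStep ⟨i, Sum.inr s⟩ ⟨i, Sum.inr s'⟩
  | exit (i : Bool) (s : S i) (y : B i) : E (l i s) y → AltStep ⟨i, Sum.inr s⟩ ⟨i, Sum.inl y⟩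

variable {E T B r l R}

theorem AltStep.edge {P0 : X → Prop} {p : Bool → X → ℕ} {A : Bool → Set X}
    (hl : ∀ i, Tableau E P0 p (A i) (l i) (R i)) {a b : Σ i, B i ⊕ S i}
    (h : AltStep E T B r l R a b) : E (altLabel B l a) (altLabel B l b) := by
  cases h with
  | switch i x b _ _ h => exact h
  | attract i x y _ _ h => exact h
  | stay i s s' h => exact (hl i).edge _ _ h
  | exit i s y h => exact h

theorem altStep_win {P0 : X → Prop} {p : Bool → X → ℕ} {A : Set X} {a : Bool → ℕ}
    (ha : ∀ i, Even (a i)) (hle : ∀ i, ∀ x ∈ A, a i ≤ p i x)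
    (hT : ∀ i, ∀ x ∈ T i, p i x = a i) (hBA : ∀ i, B i ⊆ A)
    (hl : ∀ i, Tableau E P0 p (A \ B i) (l i) (R i))
    {f : ℕ → Σ i, B i ⊕ S i} (hf : ∀ n, AltStep E T B r l R (f n) (f (n + 1))) (j : Bool) :
    EvenInf fun n => p j (altLabel B l (f n)) := by
  have hsw : ∀ n, (f n).1 ≠ (f (n + 1)).1 →
      altLabel B l (f n) ∈ T (f n).1 ∧ (f (n + 1)).1 = !(f n).1 := by
    intro n hne
    have := hf n
    revert hne this
    generalize f n = u
    generalize f (n + 1) = v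
    intro hne h
    cases h with
    | switch i x b h1 h2 h => exact ⟨h1, h2⟩
    | attract i x y _ _ h => exact (hne rfl).elim
    | stay i s s' h => exact (hne rfl).elim
    | exit i s y h => exact (hne rfl).elim
  have hmemA : ∀ b, altLabel B l b ∈ A := by
    rintro ⟨i, x | s⟩
    · exact hBA i x.2
    · exact ((hl i).mem s).1
  by_cases hinf : ∀ N, ∃ n, N ≤ n ∧ (f n).1 ≠ (f (n + 1)).1
  · have hj : ∀ N, ∃ n, N ≤ n ∧ p j (altLabel B l (f n)) = a j := by
      intro N
      by_contra! hcon
      have hstay : ∀ n, N ≤ n → (f n).1 = j → (f (n + 1)).1 = j := by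
        intro n hn hnj
        by_contra hne
        have := (hsw n (fun h => hne (h ▸ hnj))).1
        rw [hnj] at this
        exact hcon n hn (hT j _ this)
      obtain ⟨n, hn, hne⟩ := hinf N
      have hn1 : (f (n + 1)).1 = j := by
        have h1 := (hsw n hne).2
        by_cases h2 : (f n).1 = j
        · exact hstay n hn h2
        · rw [h1]
          revert h2
          cases (f n).1 <;> cases j <;> simp
      have hall : ∀ k, (f (n + 1 + k)).1 = j := by
        intro k
        induction k with
        | zero => exact hn1
        | succ k ih => exact hstay (n + 1 + k) (by omega) ih
      obtain ⟨m, hm, hne'⟩ := hinf (n + 1)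
      obtain ⟨k, rfl⟩ := Nat.exists_eq_add_of_le hm
      exact hne' ((hall k).trans (hall (k + 1)).symm)
    intro q hq
    have : IsMinInf (fun n => p j (altLabel B l (f n))) (a j) :=
      ⟨hj, 0, fun n _ => hle j _ (hmemA _)⟩
    rw [hq.unique this]
    exact ha j
  · push Not at hinf
    obtain ⟨N, hN⟩ := hinf
    have hmode : ∀ k, (f (N + k)).1 = (f N).1 := by
      intro k
      induction k with
      | zero => rfl
      | succ k ih => rw [← ih]; exact (hN (N + k) (by omega)).symm
    generalize hi : (f N).1 = i at hmode
    have hatt : ∀ k (x : B i), f (N + k) = ⟨i, Sum.inl x⟩ →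
        ∃ y : B i, f (N + (k + 1)) = ⟨i, Sum.inl y⟩ ∧ r i y < r i x := by
      intro k x hx
      have h1 := hf (N + k)
      have h2 := hmode (k + 1)
      rw [hx] at h1
      rw [← add_assoc] at h2 ⊢
      revert h1 h2
      generalize f (N + k + 1) = v
      intro h1 h2
      cases h1 with
      | switch i x b h3 h4 h =>
        rw [h2] at h4
        cases i <;> simp at h4
      | attract i x y _ hr h => exact ⟨y, rfl, hr⟩
    have hno : ∀ d k (x : B i), f (N + k) = ⟨i, Sum.inl x⟩ → r i x ≤ d → False := by
      intro d
      induction d with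
      | zero =>
        intro k x hx hd
        obtain ⟨y, hy, hlt⟩ := hatt k x hx
        omega
      | succ d ih =>
        intro k x hx hd
        obtain ⟨y, hy, hlt⟩ := hatt k x hx
        exact ih _ y hy (by omega)
    have hS : ∀ k, ∃ s : S i, f (N + k) = ⟨i, Sum.inr s⟩ := by
      intro k
      have h1 := hmode k
      rcases hfk : f (N + k) with ⟨i', x | s⟩
      · rw [hfk] at h1
        cases h1
        exact (hno _ k x hfk le_rfl).elim
      · rw [hfk] at h1
        cases h1
        exact ⟨s, rfl⟩
    choose s hs using hS
    have hR : ∀ k, R i (s k) (s (k + 1)) := by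
      intro k
      have h1 := hf (N + k)
      have h2 := hs (k + 1)
      rw [← add_assoc] at h2
      rw [hs k, h2] at h1
      cases h1 with
      | stay i s s' h => exact h
    refine EvenInf.of_shift N ?_
    have := (hl i).win s hR j
    convert this using 3 with n
    rw [add_comm, hs n]
    rfl

end Alternate

section Absorb

variable {X : Type} (E : X → X → Prop) (U B : Set X) (r : X → ℕ) {S S' : Type} (l : S → X)
  (l' : S' → X) (R : S → S → Prop) (R' : S' → S' → Prop)

/-- The label of a memory state of the absorbing strategy. -/
def absLabel : S ⊕ (B ⊕ S') → X
  | Sum.inl s => l s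
  | Sum.inr (Sum.inl x) => x
  | Sum.inr (Sum.inr s) => l' s

/-- The strategy that attracts from `B` to `U`, follows a strategy `R` forever once `U` is reached,
and follows a strategy `R'` outside of `B`. -/
inductive AbsStep : S ⊕ (B ⊕ S') → S ⊕ (B ⊕ S') → Prop
  | absorbed (s s' : S) : R s s' → AbsStep (Sum.inl s) (Sum.inl s')
  | enter (x : B) (s s' : S) : l s = x → R s s' → AbsStep (Sum.inr (Sum.inl x)) (Sum.inl s')
  | attract (x y : B) : (x : X) ∉ U → r y < r x → E x y →
      AbsStep (Sum.inr (Sum.inl x)) (Sum.inr (Sum.inl y))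
  | stay (s s' : S') : R' s s' → AbsStep (Sum.inr (Sum.inr s)) (Sum.inr (Sum.inr s'))
  | exit (s : S') (y : B) : E (l' s) y → AbsStep (Sum.inr (Sum.inr s)) (Sum.inr (Sum.inl y))

variable {E U B r l l' R R'}

theorem absStep_win {P0 : X → Prop} {p : Bool → X → ℕ} {A' : Set X}
    (hl : Tableau E P0 p U l R) (hl' : Tableau E P0 p A' l' R')
    {f : ℕ → S ⊕ (B ⊕ S')} (hf : ∀ n, AbsStep E U B r l l' R R' (f n) (f (n + 1))) (j : Bool) :
    EvenInf fun n => p j (absLabel B l l' (f n)) := by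
  have hinl : ∀ N s, f N = Sum.inl s → EvenInf fun n => p j (absLabel B l l' (f n)) := by
    intro N s hs
    have hall : ∀ k, ∃ s : S, f (N + k) = Sum.inl s := by
      intro k
      induction k with
      | zero => exact ⟨s, hs⟩
      | succ k ih =>
        obtain ⟨t, ht⟩ := ih
        have h1 := hf (N + k)
        rw [ht] at h1
        rw [← add_assoc]
        revert h1
        generalize f (N + k + 1) = v
        intro h1
        cases h1 with
        | absorbed s s' h => exact ⟨s', rfl⟩
    choose t ht using hall
    refine EvenInf.of_shift N ?_
    have := hl.win t (fun k => by
      have h1 := hf (N + k)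
      have h2 := ht (k + 1)
      rw [← add_assoc] at h2
      rw [ht k, h2] at h1
      cases h1 with
      | absorbed s s' h => exact h) j
    convert this using 3 with n
    rw [add_comm, ht n]
    rfl
  have hB : ∀ d N (x : B), f N = Sum.inr (Sum.inl x) → r x ≤ d →
      EvenInf fun n => p j (absLabel B l l' (f n)) := by
    intro d
    induction d with
    | zero =>
      intro N x hx hd
      have h1 := hf N
      rw [hx] at h1
      generalize hv : f (N + 1) = v at h1
      cases h1 with
      | enter x s s' h h' => exact hinl _ _ hv
      | attract x y _ h _ => omega
    | succ d ih =>
      intro N x hx hd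
      have h1 := hf N
      rw [hx] at h1
      generalize hv : f (N + 1) = v at h1
      cases h1 with
      | enter x s s' h h' => exact hinl _ _ hv
      | attract x y _ h _ => exact ih _ y hv (by omega)
  by_cases hS : ∀ n, ∃ s : S', f n = Sum.inr (Sum.inr s)
  · choose t ht using hS
    have := hl'.win t (fun k => by
      have h1 := hf k
      rw [ht k, ht (k + 1)] at h1
      cases h1 with
      | stay s s' h => exact h) j
    convert this using 3 with n
    rw [ht n]
    rfl
  · push Not at hS
    obtain ⟨n, hn⟩ := hS
    rcases hfn : f n with s | x | s
    · exact hinl n s hfn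
    · exact hB _ n x hfn le_rfl
    · exact (hn s hfn).elim

end Absorb

/-- Finite-memory strategies suffice for conjunctions of two parity conditions. -/
theorem Tableau.exists_finite {X : Type} {E : X → X → Prop} {P0 : X → Prop} {p : Bool → X → ℕ}
    (n : ℕ) : ∀ {A : Set X}, A.Finite → A.ncard = n → ∀ {S : Type} {l : S → X} {R : S → S → Prop},
    Tableau E P0 p A l R →
    ∃ (T : Type) (_ : Finite T) (l' : T → X) (R' : T → T → Prop), Tableau E P0 p A l' R' := by
  classical
  induction n using Nat.strong_induction_on with
  | _ n ih =>
  intro A hA hn S l R h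
  rcases A.eq_empty_or_nonempty with rfl | hne
  · exact ⟨Empty, inferInstance, fun e => e.elim, fun e => e.elim,
      ⟨fun e => e.elim, fun x hx => hx.elim, fun e => e.elim, fun e => e.elim, fun e => e.elim,
        fun f => (f 0).elim⟩⟩
  have hsub : ∀ {A' : Set X}, A' ⊂ A → A'.ncard < n := fun h' => hn ▸ Set.ncard_lt_ncard h' hA
  have hmin : ∀ i, ∃ x ∈ A, ∀ y ∈ A, p i x ≤ p i y := fun i =>
    Set.exists_min_image A (p i) hA hne
  choose x0 hx0 hle using hmin
  by_cases hev : ∀ i, Even (p i (x0 i))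
  · have hatt : ∀ i, _ := fun i =>
      exists_attractor E P0 hA (show {x ∈ A | p i x = p i (x0 i)} ⊆ A from fun x hx => hx.1)
    choose B r hTB hBA h0 h1 h2 h3 using hatt
    have hrec : ∀ i, _ := fun i => ih (A \ B i).ncard
      (hsub ⟨Set.sdiff_subset, fun hs => (hs (hx0 i)).2 (hTB i ⟨hx0 i, rfl⟩)⟩)
      (hA.subset Set.sdiff_subset) rfl (h.restrict_trap (h2 i) (h3 i))
    choose T hTfin lT RT hT using hrec
    have hentry : ∀ i, ∀ y ∈ A, ∃ b : Σ i, B i ⊕ T i, b.1 = i ∧ altLabel B lT b = y := by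
      intro i y hy
      by_cases hyB : y ∈ B i
      · exact ⟨⟨i, Sum.inl ⟨y, hyB⟩⟩, rfl, rfl⟩
      · obtain ⟨s, rfl⟩ := (hT i).surj y ⟨hy, hyB⟩
        exact ⟨⟨i, Sum.inr s⟩, rfl, rfl⟩
    have hBfin : ∀ i, Finite (B i) := fun i => hA.subset (hBA i)
    refine ⟨Σ i, B i ⊕ T i, inferInstance, altLabel B lT,
      AltStep E (fun i => {x ∈ A | p i x = p i (x0 i)}) B r lT RT, ?_, ?_, ?_, ?_, ?_, ?_⟩
    · rintro ⟨i, x | s⟩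
      · exact hBA i x.2
      · exact ((hT i).mem s).1
    · intro x hx
      obtain ⟨b, -, hb⟩ := hentry true x hx
      exact ⟨b, hb⟩
    · exact fun _ _ hR => hR.edge hT
    · rintro ⟨i, ⟨x, hx⟩ | s⟩
      · obtain ⟨y, hy, hE⟩ := h.exists_edge (hBA i hx)
        by_cases hxT : x ∈ {x ∈ A | p i x = p i (x0 i)}
        · obtain ⟨b, hb1, rfl⟩ := hentry (!i) y hy
          exact ⟨b, AltStep.switch i ⟨x, hx⟩ b hxT hb1 hE⟩
        · by_cases hP : P0 x
          · obtain ⟨y, hy, hE, hr⟩ := h0 i x hx hxT hP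
            exact ⟨⟨i, Sum.inl ⟨y, hy⟩⟩, AltStep.attract i ⟨x, hx⟩ ⟨y, hy⟩ hxT hr hE⟩
          · obtain ⟨hyB, hr⟩ := h1 i x hx hxT hP y hy hE
            exact ⟨⟨i, Sum.inl ⟨y, hyB⟩⟩, AltStep.attract i ⟨x, hx⟩ ⟨y, hyB⟩ hxT hr hE⟩
      · obtain ⟨s', hR⟩ := (hT i).succ s
        exact ⟨_, AltStep.stay i s s' hR⟩
    · rintro ⟨i, ⟨x, hx⟩ | s⟩ hP y hy hE
      · by_cases hxT : x ∈ {x ∈ A | p i x = p i (x0 i)}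
        · obtain ⟨b, hb1, rfl⟩ := hentry (!i) y hy
          exact ⟨b, AltStep.switch i ⟨x, hx⟩ b hxT hb1 hE, rfl⟩
        · obtain ⟨hyB, hr⟩ := h1 i x hx hxT hP y hy hE
          exact ⟨⟨i, Sum.inl ⟨y, hyB⟩⟩, AltStep.attract i ⟨x, hx⟩ ⟨y, hyB⟩ hxT hr hE, rfl⟩
      · by_cases hyB : y ∈ B i
        · exact ⟨⟨i, Sum.inl ⟨y, hyB⟩⟩, AltStep.exit i s ⟨y, hyB⟩ hE, rfl⟩
        · obtain ⟨s', hR, rfl⟩ := (hT i).opp s hP y ⟨hy, hyB⟩ hE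
          exact ⟨_, AltStep.stay i s s' hR, rfl⟩
    · exact fun f hf j => altStep_win hev hle (fun i x hx => hx.2) hBA hT hf j
  · push Not at hev
    obtain ⟨i, hodd⟩ := hev
    let C : Set S := {s | ¬ ∃ m, Reach R (fun s => p i (l s) = p i (x0 i)) m s}
    have hCne : C.Nonempty := by
      by_contra hC
      have hall : ∀ s, ∃ m, Reach R (fun s => p i (l s) = p i (x0 i)) m s := fun s => by
        by_contra hs
        exact hC ⟨s, hs⟩
      obtain ⟨s, -⟩ := h.surj _ hne.some_mem
      obtain ⟨f, hf, hinf⟩ := exists_path_frequently h.succ hall s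
      exact hodd (h.win f hf i _ ⟨hinf, 0, fun n _ => hle i _ (h.mem _)⟩)
    have hCsucc : ∀ s ∈ C, ∀ s', R s s' → s' ∈ C := by
      rintro s hs s' hR ⟨m, hm⟩
      exact hs ⟨m + 1, s', hR, hm⟩
    let U : Set X := l '' C
    have hUA : U ⊆ A := by
      rintro _ ⟨s, -, rfl⟩
      exact h.mem s
    have hUlt : U ⊂ A := ⟨hUA, fun hAU => by
      obtain ⟨s, hs, e⟩ := hAU (hx0 i)
      exact hs ⟨0, congrArg (p i) e⟩⟩
    have hUtrap : ∀ x ∈ U, ¬ P0 x → ∀ y ∈ A, E x y → y ∈ U := by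
      rintro _ ⟨s, hs, rfl⟩ hP y hy hE
      obtain ⟨s', hR, rfl⟩ := h.opp s hP y hy hE
      exact ⟨s', hCsucc s hs s' hR, rfl⟩
    have hCt := h.restrict C hUA (fun s hs => ⟨s, hs, rfl⟩) (fun x hx => hx)
      (fun s hs => let ⟨s', hR⟩ := h.succ s; ⟨s', hCsucc s hs s' hR, hR⟩)
      (fun s hs s' hR _ => hCsucc s hs s' hR)
    obtain ⟨TU, hTUfin, lU, RU, hU⟩ := ih _ (hsub hUlt) (hA.subset hUA) rfl hCt
    obtain ⟨B, r, hUB, hBA, h0, h1, h2, h3⟩ := exists_attractor E P0 hA hUA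
    obtain ⟨s0, hs0⟩ := hCne
    obtain ⟨TY, hTYfin, lY, RY, hY⟩ := ih (A \ B).ncard
      (hsub ⟨Set.sdiff_subset, fun hs => (hs (h.mem s0)).2 (hUB ⟨s0, hs0, rfl⟩)⟩)
      (hA.subset Set.sdiff_subset) rfl (h.restrict_trap h2 h3)
    have hBfin : Finite B := hA.subset hBA
    refine ⟨TU ⊕ (B ⊕ TY), inferInstance, absLabel B lU lY,
      AbsStep E U B r lU lY RU RY, ?_, ?_, ?_, ?_, ?_, ?_⟩
    · rintro (s | x | s)
      · exact hUA (hU.mem s)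
      · exact hBA x.2
      · exact (hY.mem s).1
    · intro x hx
      by_cases hxB : x ∈ B
      · exact ⟨Sum.inr (Sum.inl ⟨x, hxB⟩), rfl⟩
      · obtain ⟨s, rfl⟩ := hY.surj x ⟨hx, hxB⟩
        exact ⟨Sum.inr (Sum.inr s), rfl⟩
    · intro a b hR
      cases hR with
      | absorbed s s' h => exact hU.edge _ _ h
      | enter x s s' h h' =>
        have := hU.edge _ _ h'
        rwa [h] at this
      | attract x y _ _ h => exact h
      | stay s s' h => exact hY.edge _ _ h
      | exit s y h => exact h
    · rintro (s | ⟨x, hx⟩ | s)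
      · obtain ⟨s', hR⟩ := hU.succ s
        exact ⟨_, AbsStep.absorbed s s' hR⟩
      · by_cases hxU : x ∈ U
        · obtain ⟨s, rfl⟩ := hU.surj x hxU
          obtain ⟨s', hR⟩ := hU.succ s
          exact ⟨_, AbsStep.enter ⟨_, hx⟩ s s' rfl hR⟩
        · obtain ⟨y, hy, hE⟩ := h.exists_edge (hBA hx)
          by_cases hP : P0 x
          · obtain ⟨y, hy, hE, hr⟩ := h0 x hx hxU hP
            exact ⟨_, AbsStep.attract ⟨x, hx⟩ ⟨y, hy⟩ hxU hr hE⟩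
          · obtain ⟨hyB, hr⟩ := h1 x hx hxU hP y hy hE
            exact ⟨_, AbsStep.attract ⟨x, hx⟩ ⟨y, hyB⟩ hxU hr hE⟩
      · obtain ⟨s', hR⟩ := hY.succ s
        exact ⟨_, AbsStep.stay s s' hR⟩
    · rintro (s | ⟨x, hx⟩ | s) hP y hy hE
      · obtain ⟨s', hR, rfl⟩ := hU.opp s hP y (hUtrap _ (hU.mem s) hP y hy hE) hE
        exact ⟨_, AbsStep.absorbed s s' hR, rfl⟩
      · by_cases hxU : x ∈ U
        · obtain ⟨s, rfl⟩ := hU.surj x hxU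
          obtain ⟨s', hR, rfl⟩ := hU.opp s hP y (hUtrap _ hxU hP y hy hE) hE
          exact ⟨_, AbsStep.enter ⟨_, hx⟩ s s' rfl hR, rfl⟩
        · obtain ⟨hyB, hr⟩ := h1 x hx hxU hP y hy hE
          exact ⟨_, AbsStep.attract ⟨x, hx⟩ ⟨y, hyB⟩ hxU hr hE, rfl⟩
      · by_cases hyB : y ∈ B
        · exact ⟨_, AbsStep.exit s ⟨y, hyB⟩ hE, rfl⟩
        · obtain ⟨s', hR, rfl⟩ := hY.opp s hP y ⟨hy, hyB⟩ hE
          exact ⟨_, AbsStep.stay s s' hR, rfl⟩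
    · exact fun f hf j => absStep_win hU hY hf j

theorem hist_congr {α : Type*} {p p' : ℕ → α} {n : ℕ} (h : ∀ i < n, p i = p' i) :
    hist p n = hist p' n :=
  List.map_congr_left fun i hi => h i (List.mem_range.1 hi)

theorem hist_succ {α : Type*} (p : ℕ → α) (n : ℕ) : hist p (n + 1) = hist p n ++ [p n] := by
  simp [hist, List.range_succ]

@[simp] theorem length_hist {α : Type*} (p : ℕ → α) (n : ℕ) : (hist p n).length = n := by
  simp [hist]

theorem SASGame.cases (G : SASGame V) (v : V) :
    (v ∈ G.V0 ∧ v ∉ G.V1 ∧ v ∉ G.Vp) ∨ (v ∉ G.V0 ∧ v ∈ G.V1 ∧ v ∉ G.Vp) ∨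
      (v ∉ G.V0 ∧ v ∉ G.V1 ∧ v ∈ G.Vp) := by
  have h1 : v ∈ G.V0 → v ∉ G.V1 := fun h => Set.disjoint_left.1 G.disj01 h
  have h2 : v ∈ G.V0 → v ∉ G.Vp := fun h => Set.disjoint_left.1 G.disj0p h
  have h3 : v ∈ G.V1 → v ∉ G.Vp := fun h => Set.disjoint_left.1 G.disj1p h
  have h4 : v ∈ G.V0 ∪ G.V1 ∪ G.Vp := G.cover ▸ Set.mem_univ v
  simp only [Set.mem_union] at h4
  tauto

theorem gLift_of_mem {G : SASGame V} {v : V} (h : v ∈ G.Vp) : GLift G v = GVert.bar v := if_pos h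

theorem gLift_of_notMem {G : SASGame V} {v : V} (h : v ∉ G.Vp) : GLift G v = GVert.base v :=
  if_neg h

theorem gValid_gLift (G : SASGame V) (v : V) : GValid G (GLift G v) := by
  rcases G.cases v with ⟨h, h', h2⟩ | ⟨h, h', h2⟩ | ⟨h, h', h2⟩
  · rw [gLift_of_notMem h2]; exact Or.inl h
  · rw [gLift_of_notMem h2]; exact Or.inr h'
  · rw [gLift_of_mem h2]; exact h2

@[simp] theorem unlift_gLift (G : SASGame V) (v : V) : (GLift G v).unlift = v := by
  unfold GLift
  split_ifs <;> rfl

theorem gLift_injective (G : SASGame V) : Function.Injective (GLift G) := fun v w h => by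
  simpa using congrArg GVert.unlift h

theorem GEdge.valid_right {G : SASGame V} {y z : GVert V} (h : GEdge G y z) : GValid G z := by
  cases y with
  | base v => obtain ⟨-, w, -, rfl⟩ := h; exact gValid_gLift G w
  | bar v => obtain ⟨hv, k, hk, hk', rfl⟩ := h; exact ⟨hv, hk, hk'⟩
  | tilde v k =>
    obtain ⟨hv, hk, hk', ⟨rfl, h⟩ | ⟨rfl, h⟩⟩ := h
    · exact ⟨hv, h⟩
    · exact ⟨hv, by omega⟩
  | hat v j => obtain ⟨-, -, w, -, rfl⟩ := h; exact gValid_gLift G w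

theorem GValid.exists_gEdge {G : SASGame V} {y : GVert V} (h : GValid G y) : ∃ z, GEdge G y z := by
  cases y with
  | base v => obtain ⟨w, hw⟩ := G.succ_nonempty v; exact ⟨_, h, w, hw, rfl⟩
  | bar v => exact ⟨_, h, 0, Even.zero, by omega, rfl⟩
  | tilde v k =>
    obtain ⟨hv, hk, hk'⟩ := h
    by_cases hle : k ≤ G.pas v
    · exact ⟨_, hv, hk, hk', Or.inl ⟨rfl, hle⟩⟩
    · exact ⟨_, hv, hk, hk', Or.inr ⟨rfl, by obtain ⟨m, rfl⟩ := hk; omega⟩⟩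
  | hat v j =>
    obtain ⟨w, hw⟩ := G.succ_nonempty v
    exact ⟨_, h.1, h.2, w, hw, rfl⟩

/-- A numbering of the configurations of the reduced game lying over a given configuration. -/
def gCode (d : ℕ) : GVert V → V × ℕ
  | .base v => (v, 0)
  | .bar v => (v, 0)
  | .tilde v k => (v, 1 + k)
  | .hat v j => (v, d + 3 + j)

theorem gCode_injOn (G : SASGame V) {d : ℕ} (hd : ∀ v, G.pas v ≤ d) :
    Set.InjOn (gCode d) {x | GValid G x} := by
  intro x hx y hy h
  have hdis : ∀ v, v ∈ G.V0 ∪ G.V1 → v ∈ G.Vp → False := by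
    intro v h1 h2
    rcases G.cases v with h | h | h <;> simp_all
  rcases x with v | v | ⟨v, k⟩ | ⟨v, k⟩ <;> rcases y with w | w | ⟨w, j⟩ | ⟨w, j⟩ <;>
    simp only [gCode, Prod.mk.injEq] at h <;> obtain ⟨rfl, h⟩ := h <;>
    have hv := hd v <;> simp only [Set.mem_ofPred_eq, GValid] at hx hy <;>
    first
    | rfl
    | exact (hdis _ hx hy).elim
    | exact (hdis _ hy hx).elim
    | (exfalso; omega)
    | (congr 1; omega)

theorem gCode_mapsTo (G : SASGame V) {d : ℕ} (hd : ∀ v, G.pas v ≤ d) :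
    Set.MapsTo (gCode d) {x | GValid G x}
      ((Finset.univ ×ˢ Finset.range (2 * d + 4) : Finset (V × ℕ)) : Set (V × ℕ)) := by
  intro x hx
  rcases x with v | v | ⟨v, k⟩ | ⟨v, k⟩ <;> have hv := hd v <;>
    simp only [Set.mem_ofPred_eq, GValid] at hx <;> simp [gCode] <;> omega

theorem finite_gValid (G : SASGame V) {d : ℕ} (hd : ∀ v, G.pas v ≤ d) :
    {x : GVert V | GValid G x}.Finite :=
  Set.Finite.of_injOn (gCode_mapsTo G hd) (gCode_injOn G hd) (Finset.finite_toSet _)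

theorem card_gValid_le (G : SASGame V) {d : ℕ} (hd : ∀ v, G.pas v ≤ d) :
    Nat.card {x : GVert V // GValid G x} ≤ Fintype.card V * (2 * d + 4) := by
  have := Set.ncard_le_ncard_of_injOn _ (gCode_mapsTo G hd) (gCode_injOn G hd)
    (Finset.finite_toSet _)
  rw [Set.ncard_coe_finset, Finset.card_product, Finset.card_univ, Finset.card_range] at this
  exact this

/-- The two priority functions of the reduced game. -/
def gPrio (G : SASGame V) (b : Bool) : GVert V → ℕ := bif b then GPs G else GPas G

/-- A winning strategy in the reduced game yields a tableau. -/
theorem GSureWin.exists_tableau {G : SASGame V} {x : GVert V}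
    (hfin : {y : GVert V | GValid G y}.Finite) (hx : GValid G x) (h : GSureWin G x) :
    ∃ A : Set (GVert V), A ⊆ {y | GValid G y} ∧ x ∈ A ∧
      (∀ y ∈ A, ¬ GP0 G y → ∀ z, GEdge G y z → z ∈ A) ∧
      ∃ (S : Type) (l : S → GVert V) (R : S → S → Prop),
        Tableau (GEdge G) (GP0 G) (gPrio G) A l R := by
  obtain ⟨σ, hσ, hwin⟩ := h
  let S : Type := {s : ℕ × (ℕ → GVert V) // s.2 0 = x ∧ ∀ i < s.1, GEdge G (s.2 i) (s.2 (i + 1)) ∧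
    (GP0 G (s.2 i) → s.2 (i + 1) = σ (hist s.2 i) (s.2 i))}
  let l : S → GVert V := fun s => s.1.2 s.1.1
  let R : S → S → Prop := fun s s' => s'.1.1 = s.1.1 + 1 ∧ ∀ i ≤ s.1.1, s'.1.2 i = s.1.2 i
  have hvalid : ∀ s : S, GValid G (l s) := by
    rintro ⟨⟨n, p⟩, h0, hp⟩
    cases n with
    | zero => exact (show p 0 = x from h0) ▸ hx
    | succ n => exact (hp n (Nat.lt_succ_self n)).1.valid_right
  have hnext : ∀ (s : S) z, GEdge G (l s) z → (GP0 G (l s) → z = σ (hist s.1.2 s.1.1) (l s)) →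
      ∃ s', R s s' ∧ l s' = z := by
    rintro ⟨⟨n, p⟩, h0, hp⟩ z hE hz
    let p' : ℕ → GVert V := fun i => if i ≤ n then p i else z
    have hp' : ∀ i ≤ n, p' i = p i := fun i hi => if_pos hi
    have hpz : p' (n + 1) = z := if_neg (by omega)
    refine ⟨⟨⟨n + 1, p'⟩, ?_, ?_⟩, ⟨rfl, hp'⟩, hpz⟩
    · exact (hp' 0 (Nat.zero_le _)).trans h0
    · intro i hi
      have hi' : i ≤ n := Nat.lt_succ_iff.1 hi
      have hh : hist p' i = hist p i := hist_congr fun j hj => hp' j (by omega)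
      change GEdge G (p' i) (p' (i + 1)) ∧ (GP0 G (p' i) → p' (i + 1) = σ (hist p' i) (p' i))
      rw [hh, hp' i hi']
      rcases Nat.lt_or_eq_of_le hi' with hlt | rfl
      · rw [hp' (i + 1) hlt]
        exact hp i hlt
      · rw [hpz]
        exact ⟨hE, hz⟩
  have hedge : ∀ s s', R s s' → GEdge G (l s) (l s') := by
    rintro ⟨⟨n, p⟩, h0, hp⟩ ⟨⟨n', p'⟩, h0', hp'⟩ ⟨hn, hpp⟩
    change n' = n + 1 at hn
    subst hn
    have := (hp' n (Nat.lt_succ_self n)).1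
    have h2 := hpp n le_rfl
    simp only at h2 this
    rw [h2] at this
    exact this
  refine ⟨Set.range l, ?_, ⟨⟨⟨0, fun _ => x⟩, rfl, fun i hi => (Nat.not_lt_zero i hi).elim⟩, rfl⟩,
    ?_, S, l, R, ?_, ?_, hedge, ?_, ?_, ?_⟩
  · rintro _ ⟨s, rfl⟩
    exact hvalid s
  · rintro _ ⟨s, rfl⟩ h0 z hz
    obtain ⟨s', -, rfl⟩ := hnext s z hz fun h => (h0 h).elim
    exact ⟨s', rfl⟩
  · exact fun s => ⟨s, rfl⟩
  · exact fun x hx => hx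
  · intro s
    by_cases h0 : GP0 G (l s)
    · obtain ⟨s', hR, -⟩ := hnext s _ (hσ (hist s.1.2 s.1.1) _ h0 (hvalid s).exists_gEdge)
        fun _ => rfl
      exact ⟨s', hR⟩
    · obtain ⟨z, hz⟩ := (hvalid s).exists_gEdge
      obtain ⟨s', hR, -⟩ := hnext s z hz fun h => (h0 h).elim
      exact ⟨s', hR⟩
  · exact fun s h0 y _ hE => hnext s y hE fun h => (h0 h).elim
  · intro f hf
    let n0 := (f 0).1.1
    have hn : ∀ k, (f k).1.1 = n0 + k := by
      intro k
      induction k with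
      | zero => rfl
      | succ k ih => rw [(hf k).1, ih]; rfl
    have hagree : ∀ m k, k ≤ m → ∀ i ≤ n0 + k, (f m).1.2 i = (f k).1.2 i := by
      intro m k hkm
      induction m, hkm using Nat.le_induction with
      | base => exact fun _ _ => rfl
      | succ m hm ih => exact fun i hi => ((hf m).2 i (by rw [hn]; omega)).trans (ih i hi)
    let q : ℕ → GVert V := fun i => (f i).1.2 i
    have hq : ∀ i k, i ≤ n0 + k → q i = (f k).1.2 i := by
      intro i k hi
      rcases le_total i k with h | h
      · exact (hagree k i h i (by omega)).symm
      · exact hagree i k h i hi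
    have hq0 : q 0 = x := (f 0).2.1
    have hplay : ∀ i, GEdge G (q i) (q (i + 1)) ∧
        (GP0 G (q i) → q (i + 1) = σ (hist q i) (q i)) := by
      intro i
      have := (f (i + 1)).2.2 i (by rw [hn]; omega)
      have hh : hist q i = hist (f (i + 1)).1.2 i :=
        hist_congr fun j hj => hq j (i + 1) (by omega)
      rwa [hh, hq i (i + 1) (by omega), hq (i + 1) (i + 1) (by omega)]
    have hrange : (Set.range q).Finite := by
      refine hfin.subset ?_
      rintro _ ⟨i, rfl⟩
      cases i with
      | zero => rw [hq0]; exact hx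
      | succ i => exact (hplay i).1.valid_right
    have hw := hwin q hq0 (fun n => (hplay n).1) fun n => (hplay n).2
    have hl : ∀ k, l (f k) = q (k + n0) := by
      intro k
      rw [hq (k + n0) k (by omega)]
      change (f k).1.2 (f k).1.1 = _
      rw [hn, add_comm]
    intro b
    simp only [hl]
    have hw' : EvenInf fun n => gPrio G b (q n) := by
      cases b
      · exact (mem_parityWin_iff hrange).1 hw.2
      · exact (mem_parityWin_iff hrange).1 hw.1
    exact hw'.shift n0

/-- `Walk R pr s t m`: a nonempty `R`-path leads from `s` to `t`, and `m` is the least priority of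
its states other than the last one. -/
inductive Walk {S : Type*} (R : S → S → Prop) (pr : S → ℕ) : S → S → ℕ → Prop
  | single {s t : S} : R s t → Walk R pr s t (pr s)
  | snoc {s t u : S} {m : ℕ} : Walk R pr s t m → R t u → Walk R pr s u (min m (pr t))

namespace Walk

variable {S : Type*} {R : S → S → Prop} {pr : S → ℕ}

theorem trans {s t u : S} {m m' : ℕ} (h : Walk R pr s t m) (h' : Walk R pr t u m') :
    Walk R pr s u (min m m') := by
  induction h' with
  | single hR => exact h.snoc hR
  | snoc _ hR ih => rw [← min_assoc]; exact ih.snoc hR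

theorem exists_path {s t : S} {m : ℕ} (h : Walk R pr s t m) :
    ∃ L, ∃ f : ℕ → S, 0 < L ∧ f 0 = s ∧ f L = t ∧ (∀ i < L, R (f i) (f (i + 1))) ∧
      (∀ i < L, m ≤ pr (f i)) ∧ ∃ i < L, pr (f i) = m := by
  induction h with
  | @single t hR =>
    refine ⟨1, fun i => if i = 0 then s else t, one_pos, rfl, rfl, ?_, ?_, 0, one_pos, rfl⟩
    · intro i hi
      obtain rfl : i = 0 := by omega
      exact hR
    · intro i hi
      obtain rfl : i = 0 := by omega
      exact le_rfl
  | @snoc t u m _ hR ih =>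
    obtain ⟨L, f, hL, h0, hLt, hf, hm, i, hi, him⟩ := ih
    refine ⟨L + 1, fun i => if i ≤ L then f i else u, by omega, by simpa using h0, by simp, ?_, ?_,
      ?_⟩
    · intro j hj
      rcases Nat.lt_or_eq_of_le (Nat.lt_succ_iff.1 hj) with hlt | rfl
      · simpa [hlt.le, Nat.succ_le_iff.2 hlt] using hf j hlt
      · simpa [hLt] using hR
    · intro j hj
      rcases Nat.lt_or_eq_of_le (Nat.lt_succ_iff.1 hj) with hlt | rfl
      · simpa [hlt.le] using Or.inl (hm j hlt)
      · simp [hLt]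
    · rcases le_total m (pr t) with hle | hle
      · exact ⟨i, by omega, by simp [hi.le, him, hle]⟩
      · exact ⟨L, by omega, by simp [hLt, hle]⟩

theorem even_of_closed (hwin : ∀ f : ℕ → S, (∀ n, R (f n) (f (n + 1))) → EvenInf fun n => pr (f n))
    {s : S} {m : ℕ} (h : Walk R pr s s m) : Even m := by
  obtain ⟨L, f, hL, h0, hLt, hf, hm, i, hi, him⟩ := h.exists_path
  refine hwin (fun n => f (n % L)) ?_ m ⟨?_, 0, fun n _ => hm _ (Nat.mod_lt _ hL)⟩
  · intro n
    have hlt := Nat.mod_lt n hL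
    have : f ((n + 1) % L) = f (n % L + 1) := by
      rcases Nat.lt_or_eq_of_le (Nat.succ_le_iff.2 hlt) with h | h
      · rw [← Nat.mod_add_mod, Nat.mod_eq_of_lt h]
      · rw [← Nat.mod_add_mod, show n % L + 1 = L from h, Nat.mod_self, h0, hLt]
    rw [this]
    exact hf _ hlt
  · intro N
    refine ⟨N * L + i, by nlinarith, ?_⟩
    simp [Nat.mod_eq_of_lt hi, him]

theorem of_seq {t : ℕ → S} {e : ℕ → ℕ} {a k : ℕ}
    (h : ∀ n, a ≤ n → n ≤ a + k → Walk R pr (t n) (t (n + 1)) (e n)) :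
    ∃ m, Walk R pr (t a) (t (a + k + 1)) m ∧ (∀ n, a ≤ n → n ≤ a + k → m ≤ e n) ∧
      ∃ n, a ≤ n ∧ n ≤ a + k ∧ e n = m := by
  induction k with
  | zero =>
    refine ⟨e a, h a le_rfl le_rfl, ?_, a, le_rfl, le_rfl, rfl⟩
    intro n h1 h2
    obtain rfl : n = a := by omega
    exact le_rfl
  | succ k ih =>
    obtain ⟨m, hW, hm, n, h1, h2, hn⟩ := ih fun n h1 h2 => h n h1 (by omega)
    refine ⟨_, hW.trans (h (a + k + 1) (by omega) (by omega)), ?_, ?_⟩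
    · intro i hi hi'
      rcases Nat.lt_or_ge i (a + k + 1) with hlt | hge
      · exact (min_le_left _ _).trans (hm i hi (by omega))
      · obtain rfl : i = a + k + 1 := by omega
        exact min_le_right _ _
    · rcases le_total m (e (a + k + 1)) with hle | hle
      · exact ⟨n, h1, by omega, by rw [hn, min_eq_left hle]⟩
      · exact ⟨a + k + 1, by omega, le_rfl, by rw [min_eq_right hle]⟩

theorem evenInf_of_seq [Finite S]
    (hwin : ∀ f : ℕ → S, (∀ n, R (f n) (f (n + 1))) → EvenInf fun n => pr (f n))
    {t : ℕ → S} {e : ℕ → ℕ} (h : ∀ n, Walk R pr (t n) (t (n + 1)) (e n)) : EvenInf e := by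
  rintro q ⟨hq, N, hN⟩
  obtain ⟨x, hx⟩ := exists_frequently_eq (Set.toFinite (Set.range t)) hq
  obtain ⟨a, ha, hea, hta⟩ := hx N
  obtain ⟨b, hb, heb, htb⟩ := hx (a + 1)
  obtain ⟨k, rfl⟩ := Nat.exists_eq_add_of_le hb
  obtain ⟨m, hW, hm, n, h1, h2, hn⟩ := of_seq (a := a) (k := k) fun n _ _ => h n
  have : m = q := le_antisymm (hea ▸ hm a le_rfl (by omega)) (hn ▸ hN n (by omega))
  rw [hta, show a + k + 1 = a + 1 + k by omega, htb, this] at hW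
  exact hW.even_of_closed hwin

end Walk

section Cylinders

variable {α : Type*} (Low : List α → α → Prop) (s : List α → α → α)

open Classical in
/-- During the `T` steps after time `n`, the first `j` visits to `Low` are all followed by the
successor prescribed by `s`. -/
def Good (p : ℕ → α) : ℕ → ℕ → ℕ → Prop
  | 0, _, _ => True
  | T + 1, j, n =>
    if Low (hist p n) (p n) then
      match j with
      | 0 => True
      | j + 1 => p (n + 1) = s (hist p n) (p n) ∧ Good p T j (n + 1)
    else Good p T j (n + 1)

variable {Low s}

theorem good_succ_of_not {p : ℕ → α} {T j n : ℕ} (h : ¬ Low (hist p n) (p n)) :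
    Good Low s p (T + 1) j n ↔ Good Low s p T j (n + 1) := by
  cases j <;> rw [Good, if_neg h]

theorem Good.mono {p : ℕ → α} {T j n : ℕ} (h : Good Low s p (T + 1) j n) : Good Low s p T j n := by
  induction T generalizing j n with
  | zero => trivial
  | succ T ih =>
    by_cases hl : Low (hist p n) (p n)
    · cases j with
      | zero => rw [Good, if_pos hl]; trivial
      | succ j =>
        rw [Good, if_pos hl] at h ⊢
        exact ⟨h.1, ih h.2⟩
    · rw [good_succ_of_not hl] at h ⊢
      exact ih h

theorem Good.exists_repeat {p : ℕ → α} (hlow : ∀ n, ∃ m, n ≤ m ∧ Low (hist p m) (p m))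
    {T : Type*} [Fintype T] (f : ℕ → T) {j n : ℕ} (h : ∀ k, Good Low s p k j n) (F : Finset T)
    (hF : Fintype.card T < j + F.card) :
    ∃ b, n ≤ b ∧ (∀ i, n ≤ i → i < b → Low (hist p i) (p i) → p (i + 1) = s (hist p i) (p i)) ∧
      (f b ∈ F ∨ ∃ a, n ≤ a ∧ a < b ∧ Low (hist p a) (p a) ∧ f a = f b) := by
  classical
  induction j generalizing n F with
  | zero => exact absurd F.card_le_univ (by omega)
  | succ j ih =>
    obtain ⟨t, hnt, hlt, hmin⟩ : ∃ t, n ≤ t ∧ Low (hist p t) (p t) ∧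
        ∀ i, n ≤ i → i < t → ¬ Low (hist p i) (p i) := by
      have := hlow n
      exact ⟨Nat.find this, (Nat.find_spec this).1, (Nat.find_spec this).2,
        fun i hi hit hl => Nat.find_min this hit ⟨hi, hl⟩⟩
    have hgood : ∀ i, n ≤ i → i ≤ t → ∀ k, Good Low s p k (j + 1) i := by
      intro i hi
      induction i, hi using Nat.le_induction with
      | base => exact fun _ => h
      | succ i hi ihi =>
        intro hit k
        have := ihi (by omega) (k + 1)
        rwa [good_succ_of_not (hmin i hi (by omega))] at this
    have ht : ∀ k, p (t + 1) = s (hist p t) (p t) ∧ Good Low s p k j (t + 1) := by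
      intro k
      have := hgood t hnt le_rfl (k + 1)
      rwa [Good, if_pos hlt] at this
    by_cases hft : f t ∈ F
    · exact ⟨t, hnt, fun i hi hit hl => (hmin i hi hit hl).elim, Or.inl hft⟩
    · obtain ⟨b, htb, hb, hfb⟩ := ih (fun k => (ht k).2) (insert (f t) F)
        (by rw [Finset.card_insert_of_notMem hft]; omega)
      refine ⟨b, by omega, ?_, ?_⟩
      · intro i hi hib hl
        rcases lt_trichotomy i t with hit | rfl | hit
        · exact (hmin i hi hit hl).elim
        · exact (ht 0).1
        · exact hb i hit hib hl
      · rcases hfb with hfb | ⟨a, ha, hab, hl, he⟩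
        · rcases Finset.mem_insert.1 hfb with hfb | hfb
          · exact Or.inr ⟨t, hnt, by omega, hlt, hfb.symm⟩
          · exact Or.inl hfb
        · exact Or.inr ⟨a, by omega, hab, hl, he⟩

/-- The set of sequences agreeing with `h` up to time `n`. -/
def Cyl (h : ℕ → α) (n : ℕ) : Set (ℕ → α) := {p | ∀ i ≤ n, p i = h i}

theorem cyl_update [DecidableEq α] (h : ℕ → α) (n : ℕ) (w : α) :
    Cyl (Function.update h (n + 1) w) (n + 1) = Cyl h n ∩ {p | p (n + 1) = w} := by
  ext p
  constructor
  · intro hp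
    refine ⟨fun i hi => ?_, by simpa using hp (n + 1) le_rfl⟩
    have := hp i (by omega)
    rwa [Function.update_of_ne (by omega)] at this
  · rintro ⟨h1, h2⟩ i hi
    rcases Nat.lt_or_eq_of_le hi with hi | rfl
    · rw [Function.update_of_ne (by omega)]
      exact h1 i (by omega)
    · simpa using h2

theorem hist_of_mem_cyl {h p : ℕ → α} {n : ℕ} (hp : p ∈ Cyl h n) : hist p n = hist h n :=
  hist_congr fun i hi => hp i hi.le

variable [MeasurableSpace α] [DiscreteMeasurableSpace α]

theorem measurableSet_cyl (h : ℕ → α) (n : ℕ) : MeasurableSet (Cyl h n) := by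
  have : Cyl h n = ⋂ i ∈ Finset.range (n + 1), (fun p : ℕ → α => p i) ⁻¹' {h i} := by
    ext p
    simp [Cyl]
  rw [this]
  exact Finset.measurableSet_biInter _ fun i _ => measurable_pi_apply i (MeasurableSet.of_discrete)

variable [Fintype α] {μ : Measure (ℕ → α)} {P : List α → α → α → ENNReal}

theorem measure_cyl_bad
    (hcyl : ∀ h n, μ (Cyl h (n + 1)) = μ (Cyl h n) * P (hist h n) (h n) (h (n + 1)))
    {ε : ENNReal} (hε1 : ε ≤ 1) (hP : ∀ h c, Low h c → ε ≤ P h c (s h c)) (T j : ℕ) (h : ℕ → α)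
    (n : ℕ) :
    μ (Cyl h n ∩ {p | ¬ Good Low s p T j n}) + ε ^ j * μ (Cyl h n) ≤ μ (Cyl h n) := by
  classical
  induction T generalizing j h n with
  | zero => simpa [Good] using mul_le_of_le_one_left' (pow_le_one' hε1 j)
  | succ T ih =>
    by_cases hl : Low (hist h n) (h n)
    · cases j with
      | zero =>
        have : Cyl h n ∩ {p | ¬ Good Low s p (T + 1) 0 n} = ∅ := by
          ext p
          simp only [Set.mem_inter_iff, Set.mem_ofPred_eq, Set.mem_empty_iff_false, iff_false,
            not_and, not_not]
          intro hp
          rw [Good, hist_of_mem_cyl hp, hp n le_rfl, if_pos hl]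
          trivial
        simp [this]
      | succ j =>
        set w := s (hist h n) (h n)
        set h' := Function.update h (n + 1) w with hh'
        have hc : Cyl h' (n + 1) ⊆ Cyl h n := by
          rw [hh', cyl_update]; exact Set.inter_subset_left
        have hm : μ (Cyl h' (n + 1)) = μ (Cyl h n) * P (hist h n) (h n) w := by
          have hi : ∀ i ≤ n, h' i = h i := fun i hi => by
            rw [hh', Function.update_of_ne (by omega)]
          have hce : Cyl h' n = Cyl h n := by
            ext q
            exact forall₂_congr fun i hin => by rw [hi i hin]
          rw [hcyl, hist_congr fun i hin => hi i hin.le, hi n le_rfl, hce, hh',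
            Function.update_self]
        have hsub : Cyl h n ∩ {p | ¬ Good Low s p (T + 1) (j + 1) n} ⊆
            (Cyl h n \ Cyl h' (n + 1)) ∪ (Cyl h' (n + 1) ∩ {p | ¬ Good Low s p T j (n + 1)}) := by
          rintro p ⟨hp, hb⟩
          by_cases hp' : p ∈ Cyl h' (n + 1)
          · refine Or.inr ⟨hp', fun hg => hb ?_⟩
            rw [Good, hist_of_mem_cyl hp, hp n le_rfl, if_pos hl]
            exact ⟨by simpa [hh'] using hp' (n + 1) le_rfl, hg⟩
          · exact Or.inl ⟨hp, hp'⟩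
        have h1 : ε ^ (j + 1) * μ (Cyl h n) ≤ ε ^ j * μ (Cyl h' (n + 1)) := by
          rw [hm, pow_succ, mul_assoc, mul_comm (μ _)]
          gcongr
          exact hP _ _ hl
        calc _ ≤ (μ (Cyl h n \ Cyl h' (n + 1)) +
              μ (Cyl h' (n + 1) ∩ {p | ¬ Good Low s p T j (n + 1)})) +
              ε ^ j * μ (Cyl h' (n + 1)) :=
              add_le_add ((measure_mono hsub).trans (measure_union_le _ _)) h1
          _ ≤ μ (Cyl h n \ Cyl h' (n + 1)) + μ (Cyl h' (n + 1)) := by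
              rw [add_assoc]
              gcongr
              exact ih j h' (n + 1)
          _ = μ (Cyl h n) := by
              rw [← measure_sdiff_add_inter (Cyl h n) (measurableSet_cyl h' (n + 1)),
                Set.inter_eq_self_of_subset_right hc]
    · have hpart : ∀ B : Set (ℕ → α),
          μ (Cyl h n ∩ B) = ∑ w, μ (Cyl (Function.update h (n + 1) w) (n + 1) ∩ B) := by
        intro B
        have := sum_measure_preimage_singleton (μ := μ.restrict (Cyl h n ∩ B)) Finset.univ
          (f := fun p : ℕ → α => p (n + 1))
          fun y _ => measurable_pi_apply (n + 1) (MeasurableSet.of_discrete (s := {y}))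
        rw [Finset.coe_univ, Set.preimage_univ, Measure.restrict_apply_univ] at this
        rw [← this]
        refine Finset.sum_congr rfl fun w _ => ?_
        rw [Measure.restrict_apply (measurable_pi_apply (n + 1) MeasurableSet.of_discrete),
          cyl_update]
        congr 1
        ext p
        simp only [Set.mem_inter_iff, Set.mem_preimage, Set.mem_singleton_iff, Set.mem_ofPred_eq]
        tauto
      have hcong : Cyl h n ∩ {p | ¬ Good Low s p (T + 1) j n} =
          Cyl h n ∩ {p | ¬ Good Low s p T j (n + 1)} := by
        ext p
        simp only [Set.mem_inter_iff, Set.mem_ofPred_eq]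
        refine and_congr_right fun hp => ?_
        rw [good_succ_of_not (by rwa [hist_of_mem_cyl hp, hp n le_rfl])]
      have hu := hpart Set.univ
      simp only [Set.inter_univ] at hu
      rw [hcong, hpart, hu, Finset.mul_sum, ← Finset.sum_add_distrib]
      exact Finset.sum_le_sum fun w _ => ih j _ (n + 1)

/-- A set of sequences whose relative measure in every cylinder is at most `1 - δ` is null. -/
theorem measure_eq_zero_of_cyl [IsFiniteMeasure μ] {B : Set (ℕ → α)} {δ : ENNReal} (hδ : δ ≠ 0)
    (hB : ∀ h n, μ (Cyl h n ∩ B) + δ * μ (Cyl h n) ≤ μ (Cyl h n)) : μ B = 0 := by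
  let : TopologicalSpace α := ⊥
  have : DiscreteTopology α := ⟨rfl⟩
  have : BorelSpace α := ⟨by
    rw [borel_eq_top_of_discrete]
    exact eq_top_iff.2 fun s _ => MeasurableSet.of_discrete⟩
  let : MetricSpace (ℕ → α) := TopologicalSpace.metrizableSpaceMetric (ℕ → α)
  have hopen : ∀ U : Set (ℕ → α), IsOpen U → μ (U ∩ B) + δ * μ U ≤ μ U := by
    intro U hU
    let W : ℕ → Set (ℕ → α) := fun n => {p | Cyl p n ⊆ U}
    have hWmono : Monotone W := fun a b hab p hp q hq => hp fun i hi => hq i (hi.trans hab)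
    have hWU : ⋃ n, W n = U := by
      ext p
      rw [Set.mem_iUnion]
      constructor
      · rintro ⟨n, hn⟩
        exact hn fun _ _ => rfl
      · intro hp
        obtain ⟨I, u, hu, hsub⟩ := isOpen_pi_iff.1 hU p hp
        obtain ⟨n, hn⟩ := I.bddAbove
        exact ⟨n, fun q hq => hsub fun i hi => (hq i (hn hi)) ▸ (hu i hi).2⟩
    have hWn : ∀ n, μ (W n ∩ B) + δ * μ (W n) ≤ μ (W n) := by
      classical
      intro n
      let r : (ℕ → α) → (Fin (n + 1) → α) := fun p i => p i
      let e : (Fin (n + 1) → α) → ℕ → α := fun g i => g (Fin.ofNat (n + 1) i)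
      have her : ∀ g, r ⁻¹' {g} = Cyl (e g) n := by
        intro g
        ext p
        simp only [Set.mem_preimage, Set.mem_singleton_iff, funext_iff]
        constructor
        · intro h i hi
          have := h (Fin.ofNat (n + 1) i)
          simpa [r, e, Nat.mod_eq_of_lt (Nat.lt_succ_iff.2 hi)] using this
        · intro h i
          simpa [r, e] using h i (Nat.lt_succ_iff.1 i.2)
      let F : Finset (Fin (n + 1) → α) := Finset.univ.filter fun g => Cyl (e g) n ⊆ U
      have hF : W n = r ⁻¹' (F : Set (Fin (n + 1) → α)) := by
        ext p
        have hp : p ∈ Cyl (e (r p)) n := by rw [← her]; rfl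
        have : Cyl p n = Cyl (e (r p)) n := by
          ext q
          exact forall₂_congr fun i hi => by rw [hp i hi]
        simp [W, F, this]
      have hm : ∀ g ∈ F, MeasurableSet (r ⁻¹' {g}) := fun g _ => her g ▸ measurableSet_cyl _ _
      have hmW : MeasurableSet (W n) := by
        rw [hF, ← Set.biUnion_preimage_singleton]
        exact Finset.measurableSet_biUnion _ hm
      rw [← Measure.restrict_apply hmW, hF, ← sum_measure_preimage_singleton _ hm,
        ← sum_measure_preimage_singleton _ hm, Finset.mul_sum, ← Finset.sum_add_distrib]
      refine Finset.sum_le_sum fun g hg => ?_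
      rw [Measure.restrict_apply (hm g hg), her]
      exact hB _ _
    have h1 : μ (U ∩ B) = ⨆ n, μ (W n ∩ B) := by
      rw [← hWU, Set.iUnion_inter]
      exact (Monotone.directed_le fun a b hab =>
        Set.inter_subset_inter_left _ (hWmono hab)).measure_iUnion
    have h2 : μ U = ⨆ n, μ (W n) := by
      rw [← hWU]
      exact hWmono.directed_le.measure_iUnion
    rw [h1, h2, ENNReal.mul_iSup, ENNReal.iSup_add_iSup_of_monotone]
    · exact iSup_mono hWn
    · exact fun a b hab => measure_mono (Set.inter_subset_inter_left _ (hWmono hab))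
    · exact fun a b hab => mul_le_mul_right (measure_mono (hWmono hab)) δ
  have hle : μ B + δ * μ B ≤ μ B := by
    refine le_of_forall_gt fun r hr => ?_
    obtain ⟨U, hBU, hU, hUr⟩ := B.exists_isOpen_lt_of_lt r hr
    have := hopen U hU
    rw [Set.inter_eq_self_of_subset_right hBU] at this
    exact (add_le_add le_rfl (mul_le_mul_right (measure_mono hBU) δ)).trans_lt
      (this.trans_lt hUr)
  have h0 : δ * μ B = 0 := by
    by_contra hne
    exact absurd hle (not_le.2 (ENNReal.lt_add_right (measure_ne_top μ B) hne))
  exact (mul_eq_zero.1 h0).resolve_left hδ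

/-- Almost surely, if `Low` is visited infinitely often then there is a stretch of time between two
equal labels during which all visits to `Low` are followed by the successor prescribed by `s`. -/
theorem ae_exists_repeat [IsFiniteMeasure μ]
    (hcyl : ∀ h n, μ (Cyl h (n + 1)) = μ (Cyl h n) * P (hist h n) (h n) (h (n + 1)))
    {ε : ENNReal} (hε : ε ≠ 0) (hε1 : ε ≤ 1) (hP : ∀ h c, Low h c → ε ≤ P h c (s h c))
    {T : Type*} [Finite T] (f : (ℕ → α) → ℕ → T) :
    ∀ᵐ p ∂μ, (∀ n, ∃ m, n ≤ m ∧ Low (hist p m) (p m)) →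
      ∃ a b, a < b ∧ Low (hist p a) (p a) ∧ f p a = f p b ∧
        ∀ i, a ≤ i → i < b → Low (hist p i) (p i) → p (i + 1) = s (hist p i) (p i) := by
  have := Fintype.ofFinite T
  let N := Fintype.card T + 1
  have hbad : μ {p | ∀ n, ∃ k, ¬ Good Low s p k N n} = 0 := by
    refine measure_eq_zero_of_cyl (δ := ε ^ N) (pow_ne_zero _ hε) fun h n => ?_
    have h1 : μ (Cyl h n ∩ {p | ∃ k, ¬ Good Low s p k N n}) =
        ⨆ k, μ (Cyl h n ∩ {p | ¬ Good Low s p k N n}) := by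
      rw [Set.ofPred_exists, Set.inter_iUnion]
      refine (Monotone.directed_le (monotone_nat_of_le_succ fun k => ?_)).measure_iUnion
      exact Set.inter_subset_inter_right _ fun p hp hg => hp hg.mono
    calc _ ≤ μ (Cyl h n ∩ {p | ∃ k, ¬ Good Low s p k N n}) + ε ^ N * μ (Cyl h n) := by
          gcongr
          intro hp
          exact hp n
      _ ≤ μ (Cyl h n) := by
          rw [h1, ENNReal.iSup_add]
          exact iSup_le fun k => measure_cyl_bad hcyl hε1 hP k N h n
  have hae : ∀ᵐ p ∂μ, ¬ ∀ n, ∃ k, ¬ Good Low s p k N n := by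
    rw [ae_iff]
    simpa only [not_not] using hbad
  filter_upwards [hae] with p hp hlow
  push Not at hp
  obtain ⟨n, hn⟩ := hp
  obtain ⟨b, -, hb, hfb⟩ := Good.exists_repeat hlow (f p) hn ∅ (by simp [N])
  obtain hfb | ⟨a, ha, hab, hl, he⟩ := hfb
  · simp at hfb
  · exact ⟨a, b, hab, hl, he, fun i hi => hb i (ha.trans hi)⟩

end Cylinders

namespace SASGame

variable {G : SASGame V} {v : V} {σ π : Strat V} {μ : @Measure (ℕ → V) (playMS V)}

theorem IsPlayMeasure.cyl_zero (hμ : G.IsPlayMeasure v σ π μ) (h : ℕ → V) (hv : h 0 ≠ v) :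
    μ (Cyl h 0) = 0 := by
  refine (hμ.2 h 0).trans ?_
  rw [cylProb, if_neg hv, zero_mul]

theorem IsPlayMeasure.cyl_succ (hμ : G.IsPlayMeasure v σ π μ) (h : ℕ → V) (n : ℕ) :
    μ (Cyl h (n + 1)) = μ (Cyl h n) * G.step σ π (hist h n) (h n) (h (n + 1)) := by
  have h1 := hμ.2 h n
  have h2 := hμ.2 h (n + 1)
  rw [cylProb] at h1 h2
  rw [Finset.prod_range_succ, ← mul_assoc, ← h1] at h2
  exact h2

theorem IsPlayMeasure.ae_exists_repeat (hμ : G.IsPlayMeasure v σ π μ) {Low : List V → V → Prop}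
    {s : List V → V → V} {ε : ENNReal} (hε : ε ≠ 0) (hε1 : ε ≤ 1)
    (hP : ∀ h c, Low h c → ε ≤ G.step σ π h c (s h c)) {T : Type*} [Finite T]
    (f : (ℕ → V) → ℕ → T) :
    ∀ᵐ p ∂μ, (∀ n, ∃ m, n ≤ m ∧ Low (hist p m) (p m)) →
      ∃ a b, a < b ∧ Low (hist p a) (p a) ∧ f p a = f p b ∧
        ∀ i, a ≤ i → i < b → Low (hist p i) (p i) → p (i + 1) = s (hist p i) (p i) := by
  let _ : MeasurableSpace V := ⊤
  have : @IsFiniteMeasure _ (playMS V) μ := ⟨hμ.1 ▸ ENNReal.one_lt_top⟩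
  exact @_root_.ae_exists_repeat V _ s ⊤ _ _ μ (G.step σ π) this hμ.cyl_succ ε hε hε1 hP T _ f

theorem IsPlayMeasure.ae_cyl_ne_zero (μ : @Measure (ℕ → V) (playMS V)) :
    ∀ᵐ p ∂μ, ∀ n, μ (Cyl p n) ≠ 0 := by
  rw [ae_all_iff]
  intro n
  rw [ae_iff]
  let e : (Fin (n + 1) → V) → ℕ → V := fun g i => g (Fin.ofNat (n + 1) i)
  have hsub : {p : ℕ → V | ¬ μ (Cyl p n) ≠ 0} ⊆
      ⋃ g : {g : Fin (n + 1) → V // μ (Cyl (e g) n) = 0}, Cyl (e g) n := by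
    intro p hp
    rw [Set.mem_ofPred_eq, not_not] at hp
    have hpe : ∀ i ≤ n, p i = e (fun j => p j) i := fun i hi => by
      simp [e, Nat.mod_eq_of_lt (Nat.lt_succ_iff.2 hi)]
    have hc : Cyl p n = Cyl (e fun j => p j) n := by
      ext q
      exact forall₂_congr fun i hi => by rw [hpe i hi]
    exact Set.mem_iUnion.2 ⟨⟨fun j => p j, hc ▸ hp⟩, hpe⟩
  exact measure_mono_null hsub (measure_iUnion_null fun g => g.2)

theorem IsPlayMeasure.ae_step_ne_zero (hμ : G.IsPlayMeasure v σ π μ) :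
    ∀ᵐ p ∂μ, p 0 = v ∧ ∀ n, G.step σ π (hist p n) (p n) (p (n + 1)) ≠ 0 := by
  filter_upwards [IsPlayMeasure.ae_cyl_ne_zero μ] with p hp
  refine ⟨by_contra fun h => hp 0 (hμ.cyl_zero p h), fun n hn => hp (n + 1) ?_⟩
  rw [hμ.cyl_succ, hn, mul_zero]

open Classical in
theorem step_of_mem0 {h : List V} {c w : V} (hc : c ∈ G.V0) :
    G.step σ π h c w = if w = σ h c then 1 else 0 := by
  simp [step, hc]

open Classical in
theorem step_of_mem1 {h : List V} {c w : V} (hc : c ∈ G.V1) :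
    G.step σ π h c w = if w = π h c then 1 else 0 := by
  have : c ∉ G.V0 := fun h => Set.disjoint_left.1 G.disj01 h hc
  simp [step, hc, this]

theorem step_of_memp {h : List V} {c w : V} (hc : c ∈ G.Vp) : G.step σ π h c w = G.κ c w := by
  have h0 : c ∉ G.V0 := fun h => Set.disjoint_left.1 G.disj0p h hc
  have h1 : c ∉ G.V1 := fun h => Set.disjoint_left.1 G.disj1p h hc
  simp [step, h0, h1]

theorem edge_of_step_ne_zero (hσ : G.Valid0 σ) (hπ : G.Valid1 π) {h : List V} {c w : V}
    (hs : G.step σ π h c w ≠ 0) :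
    G.E c w ∧ (c ∈ G.V0 → w = σ h c) ∧ (c ∈ G.V1 → w = π h c) := by
  rcases G.cases c with ⟨h0, h1, -⟩ | ⟨h0, h1, -⟩ | ⟨h0, h1, hp⟩
  · rw [step_of_mem0 h0] at hs
    have : w = σ h c := by_contra fun h => hs (if_neg h)
    exact ⟨this ▸ hσ h c h0, fun _ => this, fun h => (h1 h).elim⟩
  · rw [step_of_mem1 h1] at hs
    have : w = π h c := by_contra fun h => hs (if_neg h)
    exact ⟨this ▸ hπ h c h1, fun h => (h0 h).elim, fun _ => this⟩
  · rw [step_of_memp hp] at hs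
    exact ⟨(G.κ_pos c hp w).1 (pos_iff_ne_zero.2 hs), fun h => (h0 h).elim, fun h => (h1 h).elim⟩

theorem sum_step (G : SASGame V) (σ π : Strat V) (h : List V) (c : V) :
    ∑ w, G.step σ π h c w = 1 := by
  classical
  rcases G.cases c with ⟨h0, h1, -⟩ | ⟨h0, h1, -⟩ | ⟨h0, h1, hp⟩
  · simp [step_of_mem0 h0]
  · simp [step_of_mem1 h1]
  · simp only [step_of_memp hp, G.κ_sum c hp]

theorem exists_pos_le_kappa (G : SASGame V) :
    ∃ ε : ENNReal, ε ≠ 0 ∧ ε ≤ 1 ∧ ∀ c ∈ G.Vp, ∀ w, G.E c w → ε ≤ G.κ c w := by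
  classical
  let F : Finset ENNReal := insert 1 (((Finset.univ : Finset (V × V)).filter
    fun x => x.1 ∈ G.Vp ∧ G.E x.1 x.2).image fun x => G.κ x.1 x.2)
  have hF : F.Nonempty := ⟨1, Finset.mem_insert_self _ _⟩
  refine ⟨F.min' hF, ?_, F.min'_le 1 (Finset.mem_insert_self _ _), fun c hc w hE => ?_⟩
  · rcases Finset.mem_insert.1 (F.min'_mem hF) with h | h
    · rw [h]; exact one_ne_zero
    · obtain ⟨x, hx, hxe⟩ := Finset.mem_image.1 h
      rw [← hxe]
      exact ((G.κ_pos _ (Finset.mem_filter.1 hx).2.1 _).2 (Finset.mem_filter.1 hx).2.2).ne'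
  · exact F.min'_le _ (Finset.mem_insert_of_mem (Finset.mem_image.2
      ⟨(c, w), Finset.mem_filter.2 ⟨Finset.mem_univ _, hc, hE⟩, rfl⟩))

/-- The state (history, current configuration) at time `n` of the play determined by a choice of
successors. -/
def stateOf {α : Type*} (v : α) (ω : List α × α → α) : ℕ → List α × α
  | 0 => ([], v)
  | n + 1 => ((stateOf v ω n).1 ++ [(stateOf v ω n).2], ω (stateOf v ω n))

theorem stateOf_eq {α : Type*} (v : α) (ω : List α × α → α) (n : ℕ) :
    stateOf v ω n = (hist (fun i => (stateOf v ω i).2) n, (stateOf v ω n).2) := by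
  induction n with
  | zero => rfl
  | succ n ih =>
    refine Prod.ext ?_ rfl
    change (stateOf v ω n).1 ++ [(stateOf v ω n).2] = hist _ (n + 1)
    rw [hist_succ, ih]

theorem measurable_stateOf [MeasurableSpace V] [DiscreteMeasurableSpace V] (v : V) (n : ℕ) :
    Measurable[_, ⊤] fun ω : List V × V → V => stateOf v ω n := by
  let : MeasurableSpace (List V × V) := ⊤
  have : Countable (List V × V) := inferInstance
  induction n with
  | zero => exact measurable_const
  | succ n ih =>
    refine measurable_to_countable' fun x => ?_
    have : (fun ω : List V × V → V => stateOf v ω (n + 1)) ⁻¹' {x} =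
        ⋃ y : List V × V, (fun ω => stateOf v ω n) ⁻¹' {y} ∩
          {ω | (y.1 ++ [y.2], ω y) = x} := by
      ext ω
      simp [stateOf]
    rw [this]
    refine MeasurableSet.iUnion fun y => (ih (MeasurableSet.of_discrete)).inter ?_
    exact measurable_pi_apply (X := fun _ => V) y (MeasurableSet.of_discrete (s := {w | (y.1 ++ [y.2], w) = x}))

/-- The Markov chain determined by two strategies has a play measure. -/
theorem exists_isPlayMeasure (G : SASGame V) (v : V) (σ π : Strat V) :
    ∃ μ, G.IsPlayMeasure v σ π μ := by
  classical
  let : MeasurableSpace V := ⊤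
  let ν : List V × V → Measure V := fun x =>
    ∑ w, G.step σ π x.1 x.2 w • Measure.dirac w
  have hνs : ∀ x w, ν x {w} = G.step σ π x.1 x.2 w := by
    intro x w
    simp [ν, Measure.finsetSum_apply, Set.indicator_apply]
  have : ∀ x, IsProbabilityMeasure (ν x) := fun x => ⟨by
    simpa [ν, Measure.finsetSum_apply] using G.sum_step σ π x.1 x.2⟩
  let Φ : (List V × V → V) → ℕ → V := fun ω n => (stateOf v ω n).2
  have hΦ : Measurable Φ := measurable_pi_lambda _ fun n =>
    (measurable_from_top (f := (Prod.snd : List V × V → V))).comp (measurable_stateOf v n)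
  have hhist : ∀ ω n, stateOf v ω n = (hist (Φ ω) n, Φ ω n) := stateOf_eq v
  refine ⟨(Measure.infinitePi ν).map Φ, ?_, fun h n => ?_⟩
  · change (Measure.infinitePi ν).map Φ Set.univ = 1
    rw [Measure.map_apply hΦ MeasurableSet.univ, Set.preimage_univ, measure_univ]
  · change (Measure.infinitePi ν).map Φ (Cyl h n) = _
    rw [Measure.map_apply hΦ (measurableSet_cyl h n), cylProb]
    by_cases hv : h 0 = v
    · let key : ℕ → List V × V := fun i => (hist h i, h i)
      have hkey : Function.Injective key := fun i j hij => by
        simpa [key] using congrArg (fun x : List V × V => x.1.length) hij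
      have hpre : Φ ⁻¹' Cyl h n =
          Set.pi ((Finset.range n).image key : Finset (List V × V))
            fun x => {h (x.1.length + 1)} := by
        ext ω
        simp only [Set.mem_preimage, Finset.coe_image, Set.mem_pi, Set.mem_image,
          Set.mem_singleton_iff, forall_exists_index, and_imp, Finset.coe_range, Set.mem_Iio]
        have hsucc : ∀ i, Φ ω (i + 1) = ω (hist (Φ ω) i, Φ ω i) := fun i => by
          rw [← hhist]; rfl
        constructor
        · rintro hc _ i hi rfl
          simp only [key, length_hist]
          rw [← hc (i + 1) hi, hsucc, hist_congr fun j hj => hc j (by omega), hc i hi.le]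
        · intro hc i
          induction i using Nat.strong_induction_on with
          | _ i ih =>
            intro hi
            cases i with
            | zero => exact hv.symm
            | succ i =>
              have := hc _ i hi rfl
              simp only [key, length_hist] at this
              rw [← this, hsucc, hist_congr fun j hj => ih j (by omega) (by omega),
                ih i (by omega) (by omega)]
      rw [hpre, Measure.infinitePi_pi _ fun x _ => MeasurableSet.of_discrete,
        Finset.prod_image fun _ _ _ _ h => hkey h, if_pos hv, one_mul]
      exact Finset.prod_congr rfl fun i _ => by simp [hνs, key]
    · have : Φ ⁻¹' Cyl h n = ∅ := by
        ext ω
        simp only [Set.mem_preimage, Set.mem_empty_iff_false, iff_false]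
        exact fun hc => hv (hc 0 (Nat.zero_le _)).symm
      rw [this, measure_empty, if_neg hv, zero_mul]

end SASGame

section OfSureWin

variable {G : SASGame V} {A : Set (GVert V)} {T : Type} {l : T → GVert V} {R : T → T → Prop}

theorem Tableau.exists_gadget_walk (hT : Tableau (GEdge G) (GP0 G) (gPrio G) A l R)
    (hA : ∀ y ∈ A, ¬ GP0 G y → ∀ z, GEdge G y z → z ∈ A) {t : T} {v : V} (ht : l t = .bar v)
    (hv : v ∈ G.Vp) {k : ℕ} (hk : Even k) (hkp : k ≤ G.pas v + 1) :
    ∃ j, (j = k ∧ k ≤ G.pas v ∨ j + 1 = k ∧ 1 ≤ j) ∧ ∃ nx : V → T, ∃ ws, G.E v ws ∧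
      ∀ w, (Even j ∨ w = ws) → G.E v w →
        l (nx w) = GLift G w ∧ Walk R (gPrio G true ∘ l) t (nx w) (G.ps v) ∧
          Walk R (gPrio G false ∘ l) t (nx w) j := by
  classical
  have hbar : ¬ GP0 G (l t) := by rw [ht]; exact id
  have hE : GEdge G (l t) (.tilde v k) := by rw [ht]; exact ⟨hv, k, hk, hkp, rfl⟩
  obtain ⟨t', hR, ht'⟩ := hT.opp t hbar _ (hA _ (hT.mem t) hbar _ hE) hE
  obtain ⟨u, hR'⟩ := hT.succ t'
  have hE' := hT.edge _ _ hR'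
  rw [ht'] at hE'
  obtain ⟨j, hj, hu⟩ : ∃ j, (j = k ∧ k ≤ G.pas v ∨ j + 1 = k ∧ 1 ≤ j) ∧ l u = .hat v j := by
    obtain ⟨-, -, -, ⟨h, h'⟩ | ⟨h, h'⟩⟩ := hE'
    · exact ⟨k, Or.inl ⟨rfl, h'⟩, h⟩
    · exact ⟨k - 1, Or.inr ⟨by omega, h'⟩, h⟩
  have hjp : j ≤ G.pas v := by omega
  have hwalk : ∀ x, R u x → Walk R (gPrio G true ∘ l) t x (G.ps v) ∧
      Walk R (gPrio G false ∘ l) t x j := by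
    intro x hx
    have h1 := ((Walk.single (pr := gPrio G true ∘ l) hR).snoc hR').snoc hx
    have h2 := ((Walk.single (pr := gPrio G false ∘ l) hR).snoc hR').snoc hx
    simp only [Function.comp, ht, ht', hu, gPrio, cond_true, cond_false, GPs, GPas, min_self] at h1 h2
    rw [min_eq_right hjp] at h2
    exact ⟨h1, h2⟩
  refine ⟨j, hj, ?_⟩
  by_cases hodd : Even j
  · have hP : ¬ GP0 G (l u) := by rw [hu]; exact Nat.not_odd_iff_even.2 hodd
    have hnx : ∀ w, ∃ x, G.E v w → l x = GLift G w ∧ R u x := by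
      intro w
      by_cases hw : G.E v w
      · have hE : GEdge G (l u) (GLift G w) := by rw [hu]; exact ⟨hv, hjp, w, hw, rfl⟩
        obtain ⟨x, hx, hxl⟩ := hT.opp u hP _ (hA _ (hT.mem u) hP _ hE) hE
        exact ⟨x, fun _ => ⟨hxl, hx⟩⟩
      · exact ⟨t, fun h => (hw h).elim⟩
    choose nx hnx using hnx
    obtain ⟨ws, hws⟩ := G.succ_nonempty v
    exact ⟨nx, ws, hws, fun w _ hw => ⟨(hnx w hw).1, hwalk _ (hnx w hw).2⟩⟩
  · obtain ⟨x, hx⟩ := hT.succ u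
    have hE := hT.edge _ _ hx
    rw [hu] at hE
    obtain ⟨-, -, ws, hws, hxl⟩ := hE
    refine ⟨fun _ => x, ws, hws, ?_⟩
    rintro w (h | rfl) -
    · exact (hodd h).elim
    · exact ⟨hxl, hwalk x hx⟩

/-- One step of `G` from `v`, simulated in a tableau for the reduced game. -/
def Simulates (G : SASGame V) (l : T → GVert V) (R : T → T → Prop) (t : T) (v : V) (K : ℕ)
    (ws : V) (nx : V → T) : Prop :=
  K ≤ G.pas v ∧ G.E v ws ∧ ∀ w, G.E v w → (v ∈ G.V0 → w = ws) →
    l (nx w) = GLift G w ∧ Walk R (gPrio G true ∘ l) t (nx w) (G.ps v) ∧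
      ∃ e, Walk R (gPrio G false ∘ l) t (nx w) e ∧ K ≤ e ∧
        ∀ q, Odd q → K ≤ q → q ≤ G.pas v → (v ∈ G.Vp → w = ws) → Odd e ∧ e ≤ q

theorem Tableau.exists_simulates (hT : Tableau (GEdge G) (GP0 G) (gPrio G) A l R)
    (hA : ∀ y ∈ A, ¬ GP0 G y → ∀ z, GEdge G y z → z ∈ A) {t : T} {v : V} (ht : l t = GLift G v) :
    ∃ K ws nx, Simulates G l R t v K ws nx := by
  classical
  have hbase : v ∉ G.Vp → l t = .base v := fun h => ht.trans (gLift_of_notMem h)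
  have hwalk : v ∉ G.Vp → ∀ x, R t x → Walk R (gPrio G true ∘ l) t x (G.ps v) ∧
      Walk R (gPrio G false ∘ l) t x (G.pas v) := by
    intro hv x hx
    have h1 := Walk.single (pr := gPrio G true ∘ l) hx
    have h2 := Walk.single (pr := gPrio G false ∘ l) hx
    simp only [Function.comp, hbase hv, gPrio, cond_true, cond_false, GPs, GPas] at h1 h2
    exact ⟨h1, h2⟩
  have hq : ∀ q, Odd q → G.pas v ≤ q → q ≤ G.pas v → Odd (G.pas v) ∧ G.pas v ≤ q :=
    fun q h1 h2 h3 => ⟨le_antisymm h3 h2 ▸ h1, h2⟩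
  rcases G.cases v with ⟨h0, -, hp⟩ | ⟨h0, h1, hp⟩ | ⟨h0, -, hp⟩
  · obtain ⟨x, hx⟩ := hT.succ t
    have hE := hT.edge _ _ hx
    rw [hbase hp] at hE
    obtain ⟨-, ws, hws, hxl⟩ := hE
    refine ⟨G.pas v, ws, fun _ => x, le_rfl, hws, fun w _ hw => ?_⟩
    obtain rfl := hw h0
    exact ⟨hxl, (hwalk hp x hx).1, _, (hwalk hp x hx).2, le_rfl, fun q h1 h2 h3 _ => hq q h1 h2 h3⟩
  · have hP : ¬ GP0 G (l t) := by rw [hbase hp]; exact h0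
    have hnx : ∀ w, ∃ x, G.E v w → l x = GLift G w ∧ R t x := by
      intro w
      by_cases hw : G.E v w
      · have hE : GEdge G (l t) (GLift G w) := by rw [hbase hp]; exact ⟨Or.inr h1, w, hw, rfl⟩
        obtain ⟨x, hx, hxl⟩ := hT.opp t hP _ (hA _ (hT.mem t) hP _ hE) hE
        exact ⟨x, fun _ => ⟨hxl, hx⟩⟩
      · exact ⟨t, fun h => (hw h).elim⟩
    choose nx hnx using hnx
    obtain ⟨ws, hws⟩ := G.succ_nonempty v
    refine ⟨G.pas v, ws, nx, le_rfl, hws, fun w hw _ => ⟨(hnx w hw).1, (hwalk hp _ (hnx w hw).2).1,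
      _, (hwalk hp _ (hnx w hw).2).2, le_rfl, fun q h1 h2 h3 _ => hq q h1 h2 h3⟩⟩
  · have hbar : l t = .bar v := ht.trans (gLift_of_mem hp)
    let Q : ℕ → Prop := fun k => Even k ∧ k ≤ G.pas v ∧ ∃ nx : V → T, ∀ w, G.E v w →
      l (nx w) = GLift G w ∧ Walk R (gPrio G true ∘ l) t (nx w) (G.ps v) ∧
        Walk R (gPrio G false ∘ l) t (nx w) k
    have hQ : ∀ k, Even k → k ≤ G.pas v + 1 → Q k ∨ 2 ≤ k ∧ ∃ nx : V → T, ∃ ws, G.E v ws ∧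
        l (nx ws) = GLift G ws ∧ Walk R (gPrio G true ∘ l) t (nx ws) (G.ps v) ∧
          Walk R (gPrio G false ∘ l) t (nx ws) (k - 1) := by
      intro k hk hkp
      obtain ⟨j, ⟨rfl, hj⟩ | ⟨rfl, hj⟩, nx, ws, hws, h⟩ := hT.exists_gadget_walk hA hbar hp hk hkp
      · exact Or.inl ⟨hk, hj, nx, fun w hw => h w (Or.inl hk) hw⟩
      · exact Or.inr ⟨by omega, nx, ws, hws, h ws (Or.inr rfl) hws⟩
    have hQ0 : Q 0 := (hQ 0 Even.zero (by omega)).resolve_right fun h => by omega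
    obtain ⟨hKe, hKp, nx, hnx⟩ : Q (Nat.findGreatest Q (G.pas v)) :=
      Nat.findGreatest_spec (Nat.zero_le _) hQ0
    have hmax : ∀ k, Q k → k ≤ Nat.findGreatest Q (G.pas v) := fun k hk =>
      Nat.le_findGreatest hk.2.1 hk
    set K := Nat.findGreatest Q (G.pas v)
    rcases Nat.lt_or_eq_of_le hKp with hlt | heq
    · obtain ⟨-, nx', ws, hws, hl, hw1, hw2⟩ :=
        (hQ (K + 2) (by simpa [parity_simps] using hKe) (by omega)).resolve_left
          fun h => by have := hmax _ h; omega
      refine ⟨K, ws, fun w => if w = ws then nx' ws else nx w, hKp, hws, fun w hw _ => ?_⟩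
      by_cases hwe : w = ws
      · subst hwe
        simp only [if_true]
        refine ⟨hl, hw1, _, hw2, by omega, fun q hq hKq _ _ => ?_⟩
        rw [Nat.odd_iff] at hq ⊢
        rw [Nat.even_iff] at hKe
        omega
      · simp only [if_neg hwe]
        obtain ⟨h1, h2, h3⟩ := hnx w hw
        exact ⟨h1, h2, K, h3, le_rfl, fun q _ _ _ h => (hwe (h hp)).elim⟩
    · obtain ⟨ws, hws⟩ := G.succ_nonempty v
      refine ⟨K, ws, nx, hKp, hws, fun w hw _ => ?_⟩
      obtain ⟨h1, h2, h3⟩ := hnx w hw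
      refine ⟨h1, h2, K, h3, le_rfl, fun q hq hKq hqp _ => ?_⟩
      rw [Nat.odd_iff] at hq
      rw [Nat.even_iff] at hKe
      omega

/-- A sure-winning strategy in the reduced game yields a finite-memory winning strategy. -/
theorem GSureWin.finWins0 {v₀ : V} (hfin : {y : GVert V | GValid G y}.Finite)
    (h : GSureWin G (GLift G v₀)) : G.FinWins0 v₀ := by
  classical
  obtain ⟨A, hAv, hvA, hA, S, l', R', hS⟩ := h.exists_tableau hfin (gValid_gLift G v₀)
  obtain ⟨T, hTfin, l, R, hT⟩ := Tableau.exists_finite _ (hfin.subset hAv) rfl hS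
  obtain ⟨t₀, ht₀⟩ := hT.surj _ hvA
  have hsim : ∀ t, ∃ K ws nx, l t = GLift G (l t).unlift →
      Simulates G l R t (l t).unlift K ws nx := by
    intro t
    by_cases ht : l t = GLift G (l t).unlift
    · obtain ⟨K, ws, nx, h⟩ := hT.exists_simulates hA ht
      exact ⟨K, ws, nx, fun _ => h⟩
    · exact ⟨0, (l t).unlift, fun _ => t, fun h => (ht h).elim⟩
  choose K ws nx hsim using hsim
  replace hsim : ∀ {t v}, l t = GLift G v → Simulates G l R t v (K t) (ws t) (nx t) := by
    intro t v ht
    have hv : (l t).unlift = v := by rw [ht, unlift_gLift]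
    have := hsim t (by rw [hv, ht])
    rwa [hv] at this
  let cur : Option T → V → T := fun m v => m.elim t₀ fun t => nx t v
  let upd : Option T → V → Option T := fun m v => some (cur m v)
  choose dflt hdflt using G.succ_nonempty
  let out : Option T → V → V := fun m v => if G.E v (ws (cur m v)) then ws (cur m v) else dflt v
  let σ : Strat V := fun h v => out (h.foldl upd none) v
  let tr : List V → V → T := fun h v => cur (h.foldl upd none) v
  have htr0 : ∀ p : ℕ → V, tr (hist p 0) (p 0) = t₀ := fun p => rfl
  have htr1 : ∀ (p : ℕ → V) n, tr (hist p (n + 1)) (p (n + 1)) =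
      nx (tr (hist p n) (p n)) (p (n + 1)) := by
    intro p n
    simp only [tr, hist_succ, List.foldl_append, List.foldl_cons, List.foldl_nil]
    rfl
  have hσv : G.Valid0 σ := by
    intro h v _
    simp only [σ, out]
    split_ifs with hE
    · exact hE
    · exact hdflt v
  have hσ : ∀ {h v}, l (tr h v) = GLift G v → σ h v = ws (tr h v) := fun ht =>
    if_pos (hsim ht).2.1
  have hlab : ∀ p : ℕ → V, p 0 = v₀ → (∀ n, G.E (p n) (p (n + 1))) →
      (∀ n, p n ∈ G.V0 → p (n + 1) = σ (hist p n) (p n)) →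
      ∀ n, l (tr (hist p n) (p n)) = GLift G (p n) := by
    intro p h0 hE hp n
    induction n with
    | zero => rw [htr0, ht₀, h0]
    | succ n ih =>
      rw [htr1]
      exact ((hsim ih).2.2 _ (hE n) fun hv => (hp n hv).trans (hσ ih)).1
  refine ⟨σ, ⟨Option T, Fintype.ofFinite _, none, upd, out, fun _ _ => rfl⟩, hσv, ?_, ?_⟩
  · rintro p ⟨h0, hE, hp⟩
    have hl := hlab p h0 hE hp
    rw [mem_parityWin_iff (Set.toFinite _)]
    refine Walk.evenInf_of_seq (pr := gPrio G true ∘ l) (hT.win · · true) (t := fun n => tr (hist p n) (p n)) fun n => ?_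
    rw [htr1]
    exact ((hsim (hl n)).2.2 _ (hE n) fun hv => (hp n hv).trans (hσ (hl n))).2.1
  · intro π hπ μ hμ
    obtain ⟨ε, hε, hε1, hκ⟩ := G.exists_pos_le_kappa
    let s : List V → V → V := fun h c =>
      if c ∈ G.V0 then σ h c else if c ∈ G.V1 then π h c else ws (tr h c)
    let Low : ℕ → ℕ → List V → V → Prop := fun N q h c =>
      N ≤ h.length ∧ K (tr h c) ≤ q ∧ G.E c (ws (tr h c))
    have hlow : ∀ N q h c, Low N q h c → ε ≤ G.step σ π h c (s h c) := by
      rintro N q h c ⟨-, -, hc⟩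
      rcases G.cases c with ⟨h0, h1, -⟩ | ⟨h0, h1, -⟩ | ⟨h0, h1, hp⟩
      · rw [SASGame.step_of_mem0 h0]
        simpa [s, h0] using hε1
      · rw [SASGame.step_of_mem1 h1]
        simpa [s, h0, h1] using hε1
      · rw [SASGame.step_of_memp hp]
        simpa [s, h0, h1] using hκ c hp _ hc
    have hrep : ∀ᵐ p ∂μ, ∀ N q, (∀ n, ∃ m, n ≤ m ∧ Low N q (hist p m) (p m)) →
        ∃ a b, a < b ∧ Low N q (hist p a) (p a) ∧ tr (hist p a) (p a) = tr (hist p b) (p b) ∧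
          ∀ i, a ≤ i → i < b → Low N q (hist p i) (p i) → p (i + 1) = s (hist p i) (p i) :=
      ae_all_iff.2 fun N => ae_all_iff.2 fun q =>
        hμ.ae_exists_repeat hε hε1 (hlow N q) fun p n => tr (hist p n) (p n)
    have hmem : ∀ᵐ p ∂μ, p ∈ ParityWin G.pas := by
      filter_upwards [hrep, hμ.ae_step_ne_zero] with p hp hstep
      obtain ⟨h0, hstep⟩ := hstep
      have hstep' := fun n => SASGame.edge_of_step_ne_zero hσv hπ (hstep n)
      have hl := hlab p h0 (fun n => (hstep' n).1) fun n => (hstep' n).2.1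
      have hmac := fun n => (hsim (hl n)).2.2 _ (hstep' n).1
        fun hv => ((hstep' n).2.1 hv).trans (hσ (hl n))
      rw [mem_parityWin_iff (Set.toFinite _)]
      rintro q ⟨hq, N, hN⟩
      by_contra hodd
      rw [Nat.not_even_iff_odd] at hodd
      have hLow : ∀ n, N ≤ n → K (tr (hist p n) (p n)) ≤ q → Low N q (hist p n) (p n) :=
        fun n hn hK => ⟨by rwa [length_hist], hK, (hsim (hl n)).2.1⟩
      obtain ⟨a, b, hab, ha, hrepeat, hsucc⟩ := hp N q fun n => by
        obtain ⟨m, hm, hmq⟩ := hq (max n N)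
        exact ⟨m, (le_max_left _ _).trans hm, hLow m ((le_max_right _ _).trans hm)
          (hmq ▸ (hsim (hl m)).1)⟩
      have hNa : N ≤ a := by simpa using ha.1
      choose e he hKe heq using fun n => (hmac n).2.2
      have hod : ∀ n, a ≤ n → n < b → K (tr (hist p n) (p n)) ≤ q → Odd (e n) ∧ e n ≤ q := by
        intro n han hnb hK
        refine heq n q hodd hK (hN n (by omega)) fun hv => ?_
        rw [hsucc n han hnb (hLow n (by omega) hK)]
        have h0 : p n ∉ G.V0 := fun h => Set.disjoint_left.1 G.disj0p h hv
        have h1 : p n ∉ G.V1 := fun h => Set.disjoint_left.1 G.disj1p h hv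
        simp [s, h0, h1]
      obtain ⟨k, rfl⟩ := Nat.exists_eq_add_of_lt hab
      obtain ⟨m, hW, hm, n, han, hnb, hnm⟩ := Walk.of_seq (R := R) (pr := gPrio G false ∘ l)
        (t := fun n => tr (hist p n) (p n)) (e := e) (a := a) (k := k)
        fun n _ _ => by
          rw [htr1]
          exact he n
      simp only [← hrepeat] at hW
      have hmev := hW.even_of_closed (hT.win · · false)
      have hma := (hm a le_rfl (by omega)).trans (hod a le_rfl hab ha.2.1).2
      have := (hod n han (by omega) ((hKe n).trans (hnm ▸ hma))).1
      rw [hnm] at this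
      exact (Nat.not_even_iff_odd.2 this) hmev
    have := measure_congr (ae_eq_univ.2 (mem_ae_iff.1 hmem))
    exact this.trans hμ.1

end OfSureWin

section Ranking

variable {S : Type*} (nxt : S → S → Prop) (prob : S → Prop) (pr : S → ℕ) (q : ℕ) (D : Set S)

/-- `r` and `Hi` form a ranking of the subset `A` of `D`: inside `D`, the rank does not increase
along the moves from `Hi`, it decreases along all moves from the other non-probabilistic states,
and along some move from the other probabilistic states (which may instead leave `D`). -/
def IsRanked (A : Set S) (r : S → ℕ) (Hi : Set S) : Prop :=
  ∀ z ∈ A, (z ∈ Hi → pr z ≠ q ∧ ∀ t, nxt z t → t ∈ D → t ∈ A ∧ r t ≤ r z) ∧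
    (z ∉ Hi → ¬ prob z → ∀ t, nxt z t → t ∈ D → t ∈ A ∧ r t < r z) ∧
    (z ∉ Hi → prob z → ∃ t, nxt z t ∧ (t ∈ D → t ∈ A ∧ r t < r z))

variable {nxt prob pr q D}

theorem IsRanked.extend [Finite S] {A : Set S} {r : S → ℕ} {Hi : Set S}
    (h : IsRanked nxt prob pr q D A r Hi) {X : Set S} (hXA : ∀ z ∈ X, z ∉ A)
    (hX : (∀ z ∈ X, pr z ≠ q ∧ ∀ t, nxt z t → t ∈ D → t ∈ A ∪ X) ∨
      (∀ z ∈ X, (¬ prob z → ∀ t, nxt z t → t ∈ D → t ∈ A) ∧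
        (prob z → ∃ t, nxt z t ∧ (t ∈ D → t ∈ A)))) :
    ∃ r' Hi', IsRanked nxt prob pr q D (A ∪ X) r' Hi' := by
  classical
  obtain ⟨b, hb⟩ := (Set.toFinite (Set.range r)).bddAbove
  let r' : S → ℕ := fun z => if z ∈ A then r z else b + 1
  have hA : ∀ z ∈ A, r' z = r z := fun z hz => if_pos hz
  have hle : ∀ z ∈ A, r' z < b + 1 := fun z hz => by
    rw [hA z hz]; exact Nat.lt_succ_iff.2 (hb ⟨z, rfl⟩)
  have hle' : ∀ z, r' z ≤ b + 1 := fun z => by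
    by_cases hz : z ∈ A
    · exact (hle z hz).le
    · exact (if_neg hz).le
  have hX' : ∀ z ∈ X, r' z = b + 1 := fun z hz => if_neg (hXA z hz)
  have hold : ∀ (Hi' : Set S), (∀ z ∈ A, z ∈ Hi' ↔ z ∈ Hi) → ∀ z ∈ A,
      (z ∈ Hi' → pr z ≠ q ∧ ∀ t, nxt z t → t ∈ D → t ∈ A ∪ X ∧ r' t ≤ r' z) ∧
      (z ∉ Hi' → ¬ prob z → ∀ t, nxt z t → t ∈ D → t ∈ A ∪ X ∧ r' t < r' z) ∧
      (z ∉ Hi' → prob z → ∃ t, nxt z t ∧ (t ∈ D → t ∈ A ∪ X ∧ r' t < r' z)) := by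
    intro Hi' hHi z hz
    obtain ⟨h1, h2, h3⟩ := h z hz
    rw [hHi z hz, hA z hz]
    refine ⟨fun hh => ⟨(h1 hh).1, fun t ht htD => ?_⟩, fun hh hp t ht htD => ?_, fun hh hp => ?_⟩
    · obtain ⟨a, c⟩ := (h1 hh).2 t ht htD
      exact ⟨Or.inl a, (hA t a).symm ▸ c⟩
    · obtain ⟨a, c⟩ := h2 hh hp t ht htD
      exact ⟨Or.inl a, (hA t a).symm ▸ c⟩
    · obtain ⟨t, ht, hD⟩ := h3 hh hp
      refine ⟨t, ht, fun htD => ?_⟩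
      obtain ⟨a, c⟩ := hD htD
      exact ⟨Or.inl a, (hA t a).symm ▸ c⟩
  rcases hX with hX | hX
  · refine ⟨r', Hi ∪ X, fun z hz => ?_⟩
    rcases hz with hz | hz
    · exact hold _ (fun z hz => or_iff_left fun hh => hXA z hh hz) z hz
    · refine ⟨fun _ => ⟨(hX z hz).1, fun t ht htD => ⟨(hX z hz).2 t ht htD, ?_⟩⟩,
        fun hh => (hh (Or.inr hz)).elim, fun hh => (hh (Or.inr hz)).elim⟩
      rw [hX' z hz]
      exact hle' t
  · refine ⟨r', Hi ∩ A, fun z hz => ?_⟩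
    rcases hz with hz | hz
    · exact hold _ (fun z hz => and_iff_left hz) z hz
    · refine ⟨fun hh => (hXA z hz hh.2).elim, fun _ hp t ht htD => ?_, fun _ hp => ?_⟩
      · have := (hX z hz).1 hp t ht htD
        exact ⟨Or.inl this, (hX' z hz).symm ▸ hle t this⟩
      · obtain ⟨t, ht, hD⟩ := (hX z hz).2 hp
        exact ⟨t, ht, fun htD => ⟨Or.inl (hD htD), (hX' z hz).symm ▸ hle t (hD htD)⟩⟩

/-- `C` is a set of states that can be made recurrent, with `q` visited infinitely often. -/
def IsTrapping (nxt : S → S → Prop) (prob : S → Prop) (pr : S → ℕ) (q : ℕ) (C : Set S)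
    (d : S → ℕ) : Prop :=
  C.Nonempty ∧ (∀ z ∈ C, q ≤ pr z) ∧ (∀ z ∈ C, prob z → ∀ t, nxt z t → t ∈ C) ∧
    ∀ z ∈ C, ∃ t ∈ C, nxt z t ∧ (pr z = q ∨ d t < d z)

/-- Without trapping sets there is a ranking of the states of a closed set whose priority is at
least `q`. -/
theorem exists_isRanked [Finite S] (hsucc : ∀ z, ∃ t, nxt z t) {U : Set S}
    (hno : ∀ C ⊆ U, ∀ d, ¬ IsTrapping nxt prob pr q C d) :
    ∃ r Hi, IsRanked nxt prob pr q {z | z ∈ U ∧ q ≤ pr z} {z | z ∈ U ∧ q ≤ pr z} r Hi := by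
  set D : Set S := {z | z ∈ U ∧ q ≤ pr z}
  obtain ⟨A, ⟨hAD, r, Hi, hA⟩, hmax⟩ :=
    (Set.toFinite {A : Set S | A ⊆ D ∧ ∃ r Hi, IsRanked nxt prob pr q D A r Hi}).exists_maximal
      ⟨∅, Set.empty_subset _, fun _ => 0, ∅, fun z hz => hz.elim⟩
  have hext : ∀ X ⊆ D, X.Nonempty → (∀ z ∈ X, z ∉ A) →
      ¬ ∃ r' Hi', IsRanked nxt prob pr q D (A ∪ X) r' Hi' := by
    rintro X hXD ⟨x, hx⟩ hXA h
    exact hXA x hx (hmax ⟨Set.union_subset hAD hXD, h⟩ Set.subset_union_left (Or.inr hx))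
  by_cases hAD' : A = D
  · subst hAD'
    exact ⟨r, Hi, hA⟩
  exfalso
  have hne : (D \ A).Nonempty := Set.sdiff_nonempty.2 fun h => hAD' (hAD.antisymm h)
  have hsingle : ∀ z ∈ D \ A, (¬ prob z → ∃ t, nxt z t ∧ t ∈ D \ A) ∧
      (prob z → ∀ t, nxt z t → t ∈ D \ A) := by
    intro z hz
    by_contra hcon
    refine hext {z} (Set.singleton_subset_iff.2 hz.1) ⟨z, rfl⟩ ?_ (hA.extend ?_ (Or.inr ?_))
    · rintro _ rfl; exact hz.2
    · rintro _ rfl; exact hz.2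
    · rintro _ rfl
      refine ⟨fun hp t ht htD => ?_, fun hp => ?_⟩
      · by_contra htA
        exact hcon ⟨fun _ => ⟨t, ht, htD, htA⟩, fun hp' => (hp hp').elim⟩
      · by_contra! hcon'
        exact hcon ⟨fun hp' => (hp' hp).elim, fun _ t ht => hcon' t ht⟩
  obtain ⟨B, d, hTB, hBD, hB, -, hB', -⟩ := exists_attractor nxt (fun _ => True)
    (A := D \ A) (T := {z | z ∈ D \ A ∧ pr z = q}) (Set.toFinite _) fun z hz => hz.1
  by_cases hBA : B = D \ A
  · refine hno (D \ A) (fun z hz => hz.1.1) d ⟨hne, fun z hz => hz.1.2, fun z hz =>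
      (hsingle z hz).2, fun z hz => ?_⟩
    by_cases hq : pr z = q
    · by_cases hp : prob z
      · obtain ⟨t, ht⟩ := hsucc z
        exact ⟨t, (hsingle z hz).2 hp t ht, ht, Or.inl hq⟩
      · obtain ⟨t, ht, htD⟩ := (hsingle z hz).1 hp
        exact ⟨t, htD, ht, Or.inl hq⟩
    · obtain ⟨t, ht, hnt, hd⟩ := hB z (hBA ▸ hz) (fun h => hq h.2) trivial
      exact ⟨t, hBA ▸ ht, hnt, Or.inr hd⟩
  · have hne' : ((D \ A) \ B).Nonempty := Set.sdiff_nonempty.2 fun h => hBA (hBD.antisymm h)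
    refine hext ((D \ A) \ B) (fun z hz => hz.1.1) hne' (fun z hz => hz.1.2)
      (hA.extend (fun z hz => hz.1.2) (Or.inl fun z hz => ⟨fun hq => hz.2 (hTB ⟨hz.1, hq⟩), ?_⟩))
    intro t ht htD
    by_cases htA : t ∈ A
    · exact Or.inl htA
    · exact Or.inr ⟨⟨htD, htA⟩, fun htB => hB' z hz.1 hz.2 trivial t htB ht⟩

end Ranking

section Memory

/-- The moves of `G`, with the memory state of a Player-0 strategy added to the configurations. -/
def MemNxt {M : Type} (G : SASGame V) (upd : M → V → M) (out : M → V → V) (z t : V × M) : Prop :=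
  G.E z.1 t.1 ∧ (z.1 ∈ G.V0 → t.1 = out z.2 z.1) ∧ t.2 = upd z.2 z.1

/-- The configuration and the memory state at time `n`. -/
def memState {α M : Type} (upd : M → α → M) (m0 : M) (p : ℕ → α) (n : ℕ) : α × M :=
  (p n, (hist p n).foldl upd m0)

/-- The configurations with memory states reachable from `v`. -/
def memReach {M : Type} (G : SASGame V) (upd : M → V → M) (out : M → V → V) (m0 : M) (v : V) :
    Set (V × M) :=
  {z | ∃ (p : ℕ → V) (n : ℕ), p 0 = v ∧
    (∀ i < n, MemNxt G upd out (memState upd m0 p i) (memState upd m0 p (i + 1))) ∧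
      z = memState upd m0 p n}

variable {M : Type} {G : SASGame V} {upd : M → V → M} {out : M → V → V} {m0 : M}


theorem memState_succ_snd {α : Type} {upd : M → α → M} (p : ℕ → α) (n : ℕ) :
    (memState upd m0 p (n + 1)).2 = upd (memState upd m0 p n).2 (p n) := by
  simp [memState, hist_succ]

theorem memState_congr {α : Type} {upd : M → α → M} {p p' : ℕ → α} {n : ℕ} (h : ∀ i ≤ n, p i = p' i) :
    memState upd m0 p n = memState upd m0 p' n :=
  Prod.ext (h n le_rfl) (congrArg (List.foldl upd m0) (hist_congr fun i hi => h i hi.le))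

theorem memNxt_memState_iff {p : ℕ → V} {n : ℕ} :
    MemNxt G upd out (memState upd m0 p n) (memState upd m0 p (n + 1)) ↔
      G.E (p n) (p (n + 1)) ∧ (p n ∈ G.V0 → p (n + 1) = out ((hist p n).foldl upd m0) (p n)) := by
  simp only [MemNxt, memState_succ_snd]
  simp [memState]

theorem memReach_base (v : V) : (v, m0) ∈ memReach G upd out m0 v :=
  ⟨fun _ => v, 0, rfl, fun _ h => (Nat.not_lt_zero _ h).elim, rfl⟩

theorem memReach_step {v : V} {z t : V × M} (hz : z ∈ memReach G upd out m0 v)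
    (ht : MemNxt G upd out z t) : t ∈ memReach G upd out m0 v := by
  obtain ⟨p, n, h0, hp, rfl⟩ := hz
  let p' : ℕ → V := fun i => if i ≤ n then p i else t.1
  have hp' : ∀ i ≤ n, p' i = p i := fun i hi => if_pos hi
  have hpt : p' (n + 1) = t.1 := if_neg (by omega)
  have hst : ∀ i ≤ n, memState upd m0 p' i = memState upd m0 p i := fun i hi =>
    memState_congr fun j hj => hp' j (hj.trans hi)
  have hlast : memState upd m0 p' (n + 1) = t := by
    refine Prod.ext hpt ?_
    rw [memState_succ_snd, hst n le_rfl, hp' n le_rfl]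
    exact ht.2.2.symm
  refine ⟨p', n + 1, (hp' 0 (Nat.zero_le _)).trans h0, fun i hi => ?_, hlast.symm⟩
  rcases Nat.lt_or_eq_of_le (Nat.lt_succ_iff.1 hi) with hi | rfl
  · rw [hst i hi.le, hst (i + 1) hi]
    exact hp i hi
  · rw [hst i le_rfl, hlast]
    exact ht

theorem SASGame.IsPlayMeasure.measure_ne_one {v : V} {σ π : Strat V}
    {μ : @Measure (ℕ → V) (playMS V)} (hμ : G.IsPlayMeasure v σ π μ) {h : ℕ → V} {n : ℕ}
    (hc : μ (Cyl h n) ≠ 0) {B : Set (ℕ → V)} (hB : ∀ᵐ p ∂μ, p ∈ Cyl h n → p ∉ B) : μ B ≠ 1 := by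
  intro h1
  let _ : MeasurableSpace V := ⊤
  have hcm : MeasurableSet[playMS V] (Cyl h n) := measurableSet_cyl h n
  have hle : μ B ≤ μ (Cyl h n)ᶜ := measure_mono_ae (by
    filter_upwards [hB] with p hp hpB hpc
    exact hp hpc hpB)
  have hadd := @measure_add_measure_compl _ (playMS V) μ _ hcm
  rw [hμ.1] at hadd
  rw [h1] at hle
  refine hc (by_contra fun hne => ?_)
  have : (1 : ENNReal) < 1 := calc
    (1 : ENNReal) < 1 + μ (Cyl h n) := ENNReal.lt_add_right ENNReal.one_ne_top hne
    _ ≤ μ (Cyl h n)ᶜ + μ (Cyl h n) := by gcongr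
    _ = 1 := by rw [add_comm, hadd]
  exact lt_irrefl _ this

/-- A finite-memory winning strategy has no trapping sets of odd priority. -/
theorem SASGame.Wins0Via.not_isTrapping [Finite M] {v : V} {σ : Strat V}
    (hσ : ∀ h v, σ h v = out (h.foldl upd m0) v) (hw : G.Wins0Via v σ) {q : ℕ} (hq : Odd q)
    {C : Set (V × M)} (hC : C ⊆ memReach G upd out m0 v) (d : V × M → ℕ) :
    ¬ IsTrapping (MemNxt G upd out) (fun z => z.1 ∈ G.Vp) (fun z => G.pas z.1) q C d := by
  classical
  rintro ⟨⟨z0, hz0⟩, hge, hprob, hch⟩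
  obtain ⟨hσv, -, has⟩ := hw
  have hch' : ∀ z, ∃ t, z ∈ C → t ∈ C ∧ MemNxt G upd out z t ∧ (G.pas z.1 = q ∨ d t < d z) := by
    intro z
    by_cases hz : z ∈ C
    · obtain ⟨t, ht⟩ := hch z hz
      exact ⟨t, fun _ => ht⟩
    · exact ⟨z, fun h => (hz h).elim⟩
  choose c hc using hch'
  obtain ⟨ps, N0, hp0, hpath, rfl⟩ := hC hz0
  choose dflt hdflt using G.succ_nonempty
  let x : List V → V → V := fun h v =>
    if h.length < N0 then ps (h.length + 1) else (c (v, h.foldl upd m0)).1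
  let π : Strat V := fun h v => if G.E v (x h v) then x h v else dflt v
  have hπ : G.Valid1 π := by
    intro h v _
    simp only [π]
    split_ifs with hE
    · exact hE
    · exact hdflt v
  have hπ1 : ∀ n < N0, π (hist ps n) (ps n) = ps (n + 1) := by
    intro n hn
    have hx : x (hist ps n) (ps n) = ps (n + 1) := by simp [x, hn]
    simp only [π, hx]
    exact if_pos (hpath n hn).1
  have hπ2 : ∀ h v, N0 ≤ h.length → (v, h.foldl upd m0) ∈ C →
      π h v = (c (v, h.foldl upd m0)).1 := by
    intro h v hn hC
    have hx : x h v = (c (v, h.foldl upd m0)).1 := if_neg (not_lt.2 hn)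
    simp only [π, hx]
    exact if_pos (hc _ hC).2.1.1
  obtain ⟨μ, hμ⟩ := G.exists_isPlayMeasure v σ π
  have hcyl : ∀ n ≤ N0, μ (Cyl ps n) ≠ 0 := by
    intro n
    induction n with
    | zero =>
      intro _
      have : μ (Cyl ps 0) = 1 := (hμ.2 ps 0).trans (by simp [SASGame.cylProb, hp0])
      rw [this]
      exact one_ne_zero
    | succ n ih =>
      intro hn
      rw [hμ.cyl_succ]
      refine mul_ne_zero (ih (by omega)) ?_
      obtain ⟨hE, h0⟩ := memNxt_memState_iff.1 (hpath n hn)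
      rcases G.cases (ps n) with ⟨h, -, -⟩ | ⟨-, h, -⟩ | ⟨-, -, h⟩
      · rw [SASGame.step_of_mem0 h, hσ, if_pos (h0 h)]
        exact one_ne_zero
      · rw [SASGame.step_of_mem1 h, if_pos (hπ1 n hn).symm]
        exact one_ne_zero
      · rw [SASGame.step_of_memp h]
        exact ((G.κ_pos _ h _).2 hE).ne'
  obtain ⟨ε, hε, hε1, hκ⟩ := G.exists_pos_le_kappa
  let Low : ℕ → List V → V → Prop := fun N h x =>
    N ≤ h.length ∧ N0 ≤ h.length ∧ (x, h.foldl upd m0) ∈ C ∧ G.pas x ≠ q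
  have hlow : ∀ N h x, Low N h x → ε ≤ G.step σ π h x (c (x, h.foldl upd m0)).1 := by
    rintro N h x ⟨-, hl, hx, -⟩
    obtain ⟨hE, h0, -⟩ := (hc _ hx).2.1
    rcases G.cases x with ⟨hx0, -, -⟩ | ⟨-, hx1, -⟩ | ⟨-, -, hxp⟩
    · rw [SASGame.step_of_mem0 hx0, hσ, if_pos (h0 hx0)]
      exact hε1
    · rw [SASGame.step_of_mem1 hx1, if_pos (hπ2 h x hl hx).symm]
      exact hε1
    · rw [SASGame.step_of_memp hxp]
      exact hκ x hxp _ hE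
  refine hμ.measure_ne_one (hcyl N0 le_rfl) ?_ (has π hπ μ hμ)
  have hrep := ae_all_iff.2 fun N => hμ.ae_exists_repeat
    (s := fun h x => (c (x, h.foldl upd m0)).1) hε hε1 (hlow N)
    fun p n => memState upd m0 p n
  filter_upwards [hrep, hμ.ae_step_ne_zero] with p hp hstep hpc hwin
  replace hstep := hstep.2
  have hstep' := fun n => SASGame.edge_of_step_ne_zero hσv hπ (hstep n)
  have hnxt : ∀ n, MemNxt G upd out (memState upd m0 p n) (memState upd m0 p (n + 1)) := fun n =>
    memNxt_memState_iff.2 ⟨(hstep' n).1, fun h => ((hstep' n).2.1 h).trans (hσ _ _)⟩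
  have hsame : ∀ n, memState upd m0 p n ∈ C → p (n + 1) = (c (memState upd m0 p n)).1 →
      memState upd m0 p (n + 1) = c (memState upd m0 p n) := fun n hn h =>
    Prod.ext h ((hnxt n).2.2.trans (hc _ hn).2.1.2.2.symm)
  have hst : ∀ n, N0 ≤ n → memState upd m0 p n ∈ C := by
    intro n hn
    induction n, hn using Nat.le_induction with
    | base => rwa [memState_congr hpc]
    | succ n hn ih =>
      rcases G.cases (p n) with ⟨h, -, -⟩ | ⟨-, h, -⟩ | ⟨-, -, h⟩
      · rw [hsame n ih (((hnxt n).2.1 h).trans ((hc _ ih).2.1.2.1 h).symm)]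
        exact (hc _ ih).1
      · rw [hsame n ih (((hstep' n).2.2 h).trans (hπ2 _ _ (by simpa using hn) ih))]
        exact (hc _ ih).1
      · exact hprob _ ih h _ (hnxt n)
  rw [mem_parityWin_iff (Set.toFinite _)] at hwin
  refine Nat.not_even_iff_odd.2 hq (hwin q ⟨?_, N0, fun n hn => hge _ (hst n hn)⟩)
  by_contra! hcon
  obtain ⟨N, hN⟩ := hcon
  have hLow : ∀ n, N ≤ n → N0 ≤ n → Low N (hist p n) (p n) := fun n h h' =>
    ⟨by simpa, by simpa, hst n h', hN n h⟩
  obtain ⟨a, b, hab, ha, heq, hsucc⟩ := hp N fun n =>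
    ⟨max n (max N N0), le_max_left _ _, hLow _ (by omega) (by omega)⟩
  obtain ⟨haN, haN0, -⟩ := ha
  rw [length_hist] at haN haN0
  have hdec : ∀ i, a ≤ i → i < b → d (memState upd m0 p (i + 1)) < d (memState upd m0 p i) := by
    intro i hai hib
    have hi := hst i (by omega)
    rw [hsame i hi (hsucc i hai hib (hLow i (by omega) (by omega)))]
    exact (hc _ hi).2.2.resolve_left (hN i (by omega))
  have hlt : ∀ i, a + 1 ≤ i → i ≤ b → d (memState upd m0 p i) < d (memState upd m0 p a) := by
    intro i hi
    induction i, hi using Nat.le_induction with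
    | base => exact fun hb => hdec a le_rfl hb
    | succ i hi ih => exact fun hb => (hdec i (by omega) hb).trans (ih (by omega))
  exact lt_irrefl _ (heq ▸ hlt b hab le_rfl)

end Memory

/-- Removing the stuttering of a sequence that stays constant until the next time in `P`. -/
theorem exists_destutter {S : Type*} {Z : ℕ → S} {P : ℕ → Prop}
    (h : ∀ n, ∃ n', n ≤ n' ∧ P n' ∧ ∀ k, n ≤ k → k ≤ n' → Z k = Z n) :
    ∃ t : ℕ → ℕ, (∀ i, P (t i)) ∧ Z (t 0) = Z 0 ∧ (∀ i, Z (t (i + 1)) = Z (t i + 1)) ∧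
      ∀ e : S → ℕ, (EvenInf fun i => e (Z (t i))) → EvenInf fun n => e (Z n) := by
  choose nx hle hP hZ using h
  let t : ℕ → ℕ := fun i => Nat.rec (nx 0) (fun _ n => nx (n + 1)) i
  have hts : ∀ i, t (i + 1) = nx (t i + 1) := fun i => rfl
  have hmono : StrictMono t := strictMono_nat_of_lt_succ fun i => by
    rw [hts]
    exact hle (t i + 1)
  have hcover : ∀ I n, t I ≤ n → ∃ i, I ≤ i ∧ n ≤ t i ∧ ∀ k, n ≤ k → k ≤ t i → Z k = Z n := by
    intro I n hn
    induction n, hn using Nat.le_induction with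
    | base => exact ⟨I, le_rfl, le_rfl, fun k h h' => by rw [le_antisymm h' h]⟩
    | succ n hn ih =>
      obtain ⟨i, hi, hni, hk⟩ := ih
      rcases Nat.lt_or_eq_of_le hni with hlt | rfl
      · exact ⟨i, hi, hlt, fun k h h' => by rw [hk k (by omega) h', hk (n + 1) (by omega) hlt]⟩
      · exact ⟨i + 1, by omega, hle _, fun k h h' => hZ (t i + 1) k h h'⟩
  refine ⟨t, fun i => ?_, hZ 0 _ (hle 0) le_rfl, fun i => hZ _ _ (hle _) le_rfl, fun e he q hq => ?_⟩
  · cases i with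
    | zero => exact hP 0
    | succ i => exact hP _
  · obtain ⟨h1, N, hN⟩ := hq
    refine he q ⟨fun I => ?_, N, fun i hi => hN _ (hi.trans hmono.le_apply)⟩
    obtain ⟨n, hn, hq⟩ := h1 (t I)
    obtain ⟨i, hi, hni, hk⟩ := hcover I n hn
    exact ⟨i, hi, (congrArg e (hk (t i) hni le_rfl)).trans hq⟩

section OfFiniteMemory

variable {M : Type} {G : SASGame V} {upd : M → V → M} {out : M → V → V} {m0 : M}

/-- The configurations of the reduced game where a step of the original game takes place. -/
def GVert.IsMove {α : Type} : GVert α → Prop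
  | .base _ => True
  | .bar _ => False
  | .tilde _ _ => False
  | .hat _ _ => True

/-- The memory update of the original game, carried out in the reduced game. -/
def gUpd {α M : Type} (upd : M → α → M) (m : M) : GVert α → M
  | .base v => upd m v
  | .bar _ => m
  | .tilde _ _ => m
  | .hat v _ => upd m v

open Classical in
/-- The moves of Player 0 in the reduced game determined by a finite-memory strategy `out` of `G`,
sets `Hi q` and successors `wst q`. -/
noncomputable def gMove (G : SASGame V) (out : M → V → V) (Hi : ℕ → Set (V × M))
    (wst : ℕ → V × M → V) (m : M) : GVert V → GVert V
  | .base v => GLift G (out m v)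
  | .bar v => .bar v
  | .tilde v k => if k ≤ G.pas v ∧ ∀ q < k, Odd q → (v, m) ∈ Hi q then .hat v k else .hat v (k - 1)
  | .hat v _ => GLift G (wst (sInf {q | Odd q ∧ (v, m) ∉ Hi q}) (v, m))

/-- For every odd `q`, a ranking of the states in `U` of priority at least `q`, where the ranks
`r q` do not increase on `Hi q` and decrease outside of `Hi q`, provided that the moves `wst q` are
chosen at probabilistic configurations. -/
structure MemRanking (G : SASGame V) (upd : M → V → M) (out : M → V → V) (U : Set (V × M))
    (r : ℕ → V × M → ℕ) (Hi : ℕ → Set (V × M)) (wst : ℕ → V × M → V) : Prop where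
  out_edge : ∀ m v, v ∈ G.V0 → G.E v (out m v)
  wst_edge : ∀ q z, G.E z.1 (wst q z)
  closed : ∀ z ∈ U, ∀ t, MemNxt G upd out z t → t ∈ U
  notMem_hi : ∀ q, Odd q → ∀ z ∈ U, G.pas z.1 = q → z ∉ Hi q
  le : ∀ q, Odd q → ∀ z ∈ U, q ≤ G.pas z.1 → z ∈ Hi q → ∀ t, MemNxt G upd out z t →
    q ≤ G.pas t.1 → r q t ≤ r q z
  lt : ∀ q, Odd q → ∀ z ∈ U, q ≤ G.pas z.1 → z ∉ Hi q → ∀ t, MemNxt G upd out z t →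
    q ≤ G.pas t.1 → (z.1 ∈ G.Vp → t.1 = wst q z) → r q t < r q z

theorem exists_memRanking [Finite M] {U : Set (V × M)}
    (hout : ∀ m v, v ∈ G.V0 → G.E v (out m v))
    (hU : ∀ z ∈ U, ∀ t, MemNxt G upd out z t → t ∈ U)
    (hno : ∀ q, Odd q → ∀ C ⊆ U, ∀ d, ¬ IsTrapping (MemNxt G upd out) (fun z => z.1 ∈ G.Vp)
      (fun z => G.pas z.1) q C d) :
    ∃ r Hi wst, MemRanking G upd out U r Hi wst := by
  classical
  have hsucc : ∀ z : V × M, ∃ t, MemNxt G upd out z t := by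
    intro z
    by_cases h0 : z.1 ∈ G.V0
    · exact ⟨(out z.2 z.1, upd z.2 z.1), hout _ _ h0, fun _ => rfl, rfl⟩
    · obtain ⟨w, hw⟩ := G.succ_nonempty z.1
      exact ⟨(w, upd z.2 z.1), hw, fun h => (h0 h).elim, rfl⟩
  have hrank : ∀ q, ∃ r Hi, Odd q → IsRanked (MemNxt G upd out) (fun z => z.1 ∈ G.Vp)
      (fun z => G.pas z.1) q {z | z ∈ U ∧ q ≤ G.pas z.1} {z | z ∈ U ∧ q ≤ G.pas z.1} r Hi := by
    intro q
    by_cases hq : Odd q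
    · obtain ⟨r, Hi, h⟩ := exists_isRanked (U := U) hsucc (hno q hq)
      exact ⟨r, Hi, fun _ => h⟩
    · exact ⟨fun _ => 0, ∅, fun h => (hq h).elim⟩
  choose r Hi hrank using hrank
  have hw : ∀ q (z : V × M), ∃ w, G.E z.1 w ∧ (Odd q → z ∈ U → q ≤ G.pas z.1 → z ∉ Hi q →
      z.1 ∈ G.Vp → ((w, upd z.2 z.1) ∈ U ∧ q ≤ G.pas w → r q (w, upd z.2 z.1) < r q z)) := by
    intro q z
    by_cases h : Odd q ∧ z ∈ U ∧ q ≤ G.pas z.1 ∧ z ∉ Hi q ∧ z.1 ∈ G.Vp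
    · obtain ⟨hq, hz, hqz, hzH, hp⟩ := h
      obtain ⟨⟨w, m⟩, ⟨hE, -, rfl⟩, hD⟩ := (hrank q hq z ⟨hz, hqz⟩).2.2 hzH hp
      exact ⟨w, hE, fun _ _ _ _ _ hU => (hD hU).2⟩
    · obtain ⟨w, hw⟩ := G.succ_nonempty z.1
      exact ⟨w, hw, fun h1 h2 h3 h4 h5 => (h ⟨h1, h2, h3, h4, h5⟩).elim⟩
  choose wst hwE hwst using hw
  refine ⟨r, Hi, wst, hout, hwE, hU, fun q hq z hz hqz hzH => ?_, fun q hq z hz hqz hzH t ht htq => ?_,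
    fun q hq z hz hqz hzH t ht htq hp => ?_⟩
  · exact ((hrank q hq z ⟨hz, hqz.ge⟩).1 hzH).1 hqz
  · exact (((hrank q hq z ⟨hz, hqz⟩).1 hzH).2 t ht ⟨hU z hz t ht, htq⟩).2
  · by_cases hzp : z.1 ∈ G.Vp
    · obtain ⟨w, m⟩ := t
      obtain rfl : w = wst q z := hp hzp
      obtain rfl : m = upd z.2 z.1 := ht.2.2
      exact hwst q z hq hz hqz hzH hzp ⟨hU z hz _ ht, htq⟩
    · exact ((hrank q hq z ⟨hz, hqz⟩).2.1 hzH hzp t ht ⟨hU z hz t ht, htq⟩).2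

variable {U : Set (V × M)} {r : ℕ → V × M → ℕ} {Hi : ℕ → Set (V × M)} {wst : ℕ → V × M → V}

theorem MemRanking.gEdge_gMove (hR : MemRanking G upd out U r Hi wst) (m : M) {y : GVert V}
    (h0 : GP0 G y) (hy : ∃ z, GEdge G y z) : GEdge G y (gMove G out Hi wst m y) := by
  obtain ⟨z, hz⟩ := hy
  cases y with
  | base v => exact ⟨Or.inl h0, _, hR.out_edge m v h0, rfl⟩
  | bar v => exact h0.elim
  | tilde v k =>
    obtain ⟨hv, hk, hkp, -⟩ := hz
    refine ⟨hv, hk, hkp, ?_⟩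
    rw [gMove]
    split_ifs with h
    · exact Or.inl ⟨rfl, h.1⟩
    · refine Or.inr ⟨rfl, ?_⟩
      rw [Nat.even_iff] at hk
      by_cases hkle : k ≤ G.pas v
      · obtain ⟨q, hq, -⟩ : ∃ q < k, ¬ (Odd q → (v, m) ∈ Hi q) := by
          by_contra! hcon
          exact h ⟨hkle, hcon⟩
        omega
      · omega
  | hat v j =>
    obtain ⟨hv, hj, -⟩ := hz
    exact ⟨hv, hj, _, hR.wst_edge _ (v, m), rfl⟩

variable (G U Hi) in
/-- The invariant of the plays of the reduced game in which Player 0 moves by `gMove`. -/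
def GInv (y : GVert V) (m : M) : Prop :=
  GValid G y ∧ (y.unlift, m) ∈ U ∧ ∀ v j, y = .hat v j →
    (Even j → ∀ q < j, Odd q → (v, m) ∈ Hi q) ∧ (Odd j → ∃ q ≤ j, Odd q ∧ (v, m) ∉ Hi q)

theorem not_hat_gLift {G : SASGame V} {w v : V} {j : ℕ} : GLift G w ≠ .hat v j := by
  unfold GLift
  split_ifs <;> exact nofun

theorem MemRanking.step (hR : MemRanking G upd out U r Hi wst) {m : M} {y y' : GVert V}
    (hy : GInv G U Hi y m) (hE : GEdge G y y') (h0 : GP0 G y → y' = gMove G out Hi wst m y) :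
    GInv G U Hi y' (gUpd upd m y) ∧
      (y.IsMove → MemNxt G upd out (y.unlift, m) (y'.unlift, gUpd upd m y)) ∧
      (¬ y.IsMove → y'.unlift = y.unlift ∧ gUpd upd m y = m) := by
  have hval := hE.valid_right
  obtain ⟨hyv, hyU, hyH⟩ := hy
  cases y with
  | base v =>
    obtain ⟨-, w, hw, rfl⟩ := hE
    have hn : MemNxt G upd out (v, m) ((GLift G w).unlift, upd m v) := by
      rw [unlift_gLift]
      exact ⟨hw, fun h => gLift_injective G (h0 h), rfl⟩
    exact ⟨⟨hval, hR.closed _ hyU _ hn, fun _ _ h => (not_hat_gLift h).elim⟩, fun _ => hn,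
      fun h => (h trivial).elim⟩
  | bar v =>
    obtain ⟨-, k, -, -, rfl⟩ := hE
    exact ⟨⟨hval, hyU, nofun⟩, fun h => h.elim, fun _ => ⟨rfl, rfl⟩⟩
  | tilde v k =>
    have hy' := h0 trivial
    obtain ⟨hv, hk, hkp⟩ := hyv
    rw [gMove] at hy'
    split_ifs at hy' with h
    · subst hy'
      refine ⟨⟨hval, hyU, ?_⟩, fun h => h.elim, fun _ => ⟨rfl, rfl⟩⟩
      intro v' j hvj
      cases hvj
      exact ⟨fun _ => h.2, fun hodd => (Nat.not_even_iff_odd.2 hodd hk).elim⟩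
    · subst hy'
      refine ⟨⟨hval, hyU, ?_⟩, fun h => h.elim, fun _ => ⟨rfl, rfl⟩⟩
      intro v' j hvj
      cases hvj
      have hk0 : 1 ≤ k - 1 := by
        obtain ⟨-, -, -, ⟨he, -⟩ | ⟨-, he⟩⟩ := hE
        · have : k - 1 = k := by simpa using he
          have hk0 : k = 0 := by omega
          subst hk0
          exact (h ⟨Nat.zero_le _, fun q hq => (Nat.not_lt_zero _ hq).elim⟩).elim
        · exact he
      have hodd : Odd (k - 1) := by
        rw [Nat.even_iff] at hk
        rw [Nat.odd_iff]
        omega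
      refine ⟨fun he => (Nat.not_even_iff_odd.2 hodd he).elim, fun _ => ?_⟩
      by_cases hkle : k ≤ G.pas v
      · by_contra! hcon
        exact h ⟨hkle, fun q hq hqo => hcon q (by omega) hqo⟩
      · exact ⟨k - 1, le_rfl, hodd, hR.notMem_hi _ hodd _ hyU (show G.pas v = k - 1 by omega)⟩
  | hat v j =>
    obtain ⟨hv, -, w, hw, rfl⟩ := hE
    have hn : MemNxt G upd out (v, m) ((GLift G w).unlift, upd m v) := by
      rw [unlift_gLift]
      exact ⟨hw, fun h => (Set.disjoint_left.1 G.disj0p h hv).elim, rfl⟩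
    exact ⟨⟨hval, hR.closed _ hyU _ hn, fun _ _ h => (not_hat_gLift h).elim⟩, fun _ => hn,
      fun h => (h trivial).elim⟩

theorem GInv.gPas_le {y : GVert V} {m : M} (hy : GInv G U Hi y m) : GPas G y ≤ G.pas y.unlift := by
  cases y with
  | hat v j => exact hy.1.2
  | _ => exact le_rfl

theorem MemRanking.exists_notMem_hi (hR : MemRanking G upd out U r Hi wst) {m : M} {y : GVert V}
    (hy : GInv G U Hi y m) (hq : Odd (GPas G y)) :
    ∃ q ≤ GPas G y, Odd q ∧ (y.unlift, m) ∉ Hi q := by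
  cases y with
  | hat v j => exact (hy.2.2 v j rfl).2 hq
  | _ => exact ⟨_, le_rfl, hq, hR.notMem_hi _ hq _ hy.2.1 rfl⟩

theorem MemRanking.lt_of_isMove (hR : MemRanking G upd out U r Hi wst) {m : M} {y y' : GVert V}
    (hy : GInv G U Hi y m) (hE : GEdge G y y') (h0 : GP0 G y → y' = gMove G out Hi wst m y)
    (hm : y.IsMove) {q : ℕ} (hq : Odd q) (hqy : q ≤ GPas G y) (hqy' : q ≤ G.pas y'.unlift)
    (hH : (y.unlift, m) ∉ Hi q) (hH' : ∀ q' < q, Odd q' → (y.unlift, m) ∈ Hi q') :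
    r q (y'.unlift, gUpd upd m y) < r q (y.unlift, m) := by
  refine hR.lt q hq _ hy.2.1 (hqy.trans hy.gPas_le) hH _ ((hR.step hy hE h0).2.1 hm) hqy' ?_
  intro hp
  cases y with
  | base v =>
    obtain ⟨h0 | h1, -⟩ := hE
    · exact (Set.disjoint_left.1 G.disj0p h0 hp).elim
    · exact (Set.disjoint_left.1 G.disj1p h1 hp).elim
  | bar v => exact hm.elim
  | tilde v k => exact hm.elim
  | hat v j =>
    rcases Nat.even_or_odd j with hj | hj
    · have hqj : q < j := lt_of_le_of_ne hqy fun h => Nat.not_even_iff_odd.2 hq (h ▸ hj)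
      exact (hH ((hy.2.2 v j rfl).1 hj q hqj hq)).elim
    · have hinf : sInf {q | Odd q ∧ (v, m) ∉ Hi q} = q := by
        refine le_antisymm (Nat.sInf_le ⟨hq, hH⟩) (le_csInf ⟨q, hq, hH⟩ ?_)
        rintro q' ⟨h1, h2⟩
        exact not_lt.1 fun h => h2 (hH' q' h h1)
      rw [h0 hj, gMove, unlift_gLift, hinf]
      rfl

/-- A play of the reduced game in which Player 0 moves by `gMove`. -/
structure GPlay (G : SASGame V) (upd : M → V → M) (out : M → V → V) (m0 : M) (v : V)
    (Hi : ℕ → Set (V × M)) (wst : ℕ → V × M → V) (p : ℕ → GVert V) : Prop where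
  init : p 0 = GLift G v
  edge : ∀ n, GEdge G (p n) (p (n + 1))
  move : ∀ n, GP0 G (p n) →
    p (n + 1) = gMove G out Hi wst ((hist p n).foldl (gUpd upd) m0) (p n)

/-- The configuration of `G` and the memory state at time `n` of a play of the reduced game. -/
def gState {α M : Type} (upd : M → α → M) (m0 : M) (p : ℕ → GVert α) (n : ℕ) : α × M :=
  ((p n).unlift, (hist p n).foldl (gUpd upd) m0)

theorem gState_succ {α : Type} {upd : M → α → M} (p : ℕ → GVert α) (n : ℕ) :
    gState upd m0 p (n + 1) = ((p (n + 1)).unlift, gUpd upd (gState upd m0 p n).2 (p n)) := by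
  simp [gState, hist_succ]

variable {v : V} {p : ℕ → GVert V}

theorem GPlay.inv (hp : GPlay G upd out m0 v Hi wst p) (hR : MemRanking G upd out U r Hi wst)
    (hv : (v, m0) ∈ U) (n : ℕ) : GInv G U Hi (p n) (gState upd m0 p n).2 := by
  induction n with
  | zero =>
    rw [hp.init]
    refine ⟨gValid_gLift G v, ?_, fun _ _ h => (not_hat_gLift h).elim⟩
    rw [unlift_gLift]
    exact hv
  | succ n ih =>
    rw [gState_succ]
    exact (hR.step ih (hp.edge n) (hp.move n)).1

theorem GPlay.exists_isMove (hp : GPlay G upd out m0 v Hi wst p) (n : ℕ) :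
    ∃ n', n ≤ n' ∧ (p n').IsMove ∧
      ∀ k, n ≤ k → k ≤ n' → gState upd m0 p k = gState upd m0 p n := by
  have htilde : ∀ n u i, p n = .tilde u i → (p (n + 1)).IsMove ∧
      gState upd m0 p (n + 1) = gState upd m0 p n := by
    intro n u i hn
    have hE := hp.edge n
    rw [gState_succ, hn]
    rw [hn] at hE
    obtain ⟨-, -, -, ⟨h, -⟩ | ⟨h, -⟩⟩ := hE <;> rw [h] <;>
      exact ⟨trivial, Prod.ext (by rw [gState, hn]; rfl) rfl⟩
  cases hn : p n with
  | base u => exact ⟨n, le_rfl, by rw [hn]; trivial, fun k h h' => by rw [le_antisymm h h']⟩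
  | hat u j => exact ⟨n, le_rfl, by rw [hn]; trivial, fun k h h' => by rw [le_antisymm h h']⟩
  | tilde u i =>
    obtain ⟨h1, h2⟩ := htilde n u i hn
    refine ⟨n + 1, by omega, h1, fun k hk hk' => ?_⟩
    obtain rfl | rfl : k = n ∨ k = n + 1 := by omega
    · rfl
    · exact h2
  | bar u =>
    have hE := hp.edge n
    rw [hn] at hE
    obtain ⟨-, i, -, -, hi⟩ := hE
    obtain ⟨h1, h2⟩ := htilde (n + 1) u i hi
    have h3 : gState upd m0 p (n + 1) = gState upd m0 p n := by
      rw [gState_succ, hn, hi]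
      exact Prod.ext (by rw [gState, hn]; rfl) rfl
    refine ⟨n + 2, by omega, h1, fun k hk hk' => ?_⟩
    obtain rfl | rfl | rfl : k = n ∨ k = n + 1 ∨ k = n + 2 := by omega
    · rfl
    · exact h3
    · exact h2.trans h3

theorem GPlay.memNxt (hp : GPlay G upd out m0 v Hi wst p) (hR : MemRanking G upd out U r Hi wst)
    (hv : (v, m0) ∈ U) {n : ℕ} (hn : (p n).IsMove) :
    MemNxt G upd out (gState upd m0 p n) (gState upd m0 p (n + 1)) := by
  rw [gState_succ]
  exact (hR.step (hp.inv hR hv n) (hp.edge n) (hp.move n)).2.1 hn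

/-- The sure parity condition of the reduced game reduces to the one of `G`. -/
theorem GPlay.evenInf_gPs (hp : GPlay G upd out m0 v Hi wst p)
    (hR : MemRanking G upd out U r Hi wst) (hv : (v, m0) ∈ U) {σ : Strat V}
    (hσ : ∀ h v, σ h v = out (h.foldl upd m0) v) (hw : G.PlaysFrom v σ ⊆ ParityWin G.ps) :
    EvenInf fun n => GPs G (p n) := by
  obtain ⟨t, htP, ht0, ht1, htE⟩ := exists_destutter hp.exists_isMove
  let g : ℕ → V := fun i => (p (t i)).unlift
  have hg : ∀ i, memState upd m0 g i = gState upd m0 p (t i) := by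
    intro i
    induction i with
    | zero => exact Prod.ext rfl (congrArg Prod.snd ht0).symm
    | succ i ih =>
      refine Prod.ext rfl ?_
      rw [memState_succ_snd, ih, ht1]
      exact ((hp.memNxt hR hv (htP i)).2.2).symm
  have hnxt : ∀ i, MemNxt G upd out (memState upd m0 g i) (memState upd m0 g (i + 1)) := by
    intro i
    rw [hg, hg, ht1]
    exact hp.memNxt hR hv (htP i)
  have hplay : g ∈ G.PlaysFrom v σ := by
    refine ⟨?_, fun i => (memNxt_memState_iff.1 (hnxt i)).1, fun i hi => ?_⟩
    · refine (congrArg Prod.fst ht0).trans ?_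
      rw [gState, hp.init, unlift_gLift]
    · rw [hσ]
      exact (memNxt_memState_iff.1 (hnxt i)).2 hi
  have heven := htE (fun z => G.ps z.1) ((mem_parityWin_iff (Set.toFinite _)).1 (hw hplay))
  have hps : ∀ n, GPs G (p n) = G.ps (gState upd m0 p n).1 := by
    intro n
    rw [gState]
    cases p n <;> rfl
  simpa only [hps] using heven

/-- The almost-sure parity condition of the reduced game holds by the ranking. -/
theorem GPlay.evenInf_gPas (hp : GPlay G upd out m0 v Hi wst p)
    (hR : MemRanking G upd out U r Hi wst) (hv : (v, m0) ∈ U) :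
    EvenInf fun n => GPas G (p n) := by
  classical
  have hinv := hp.inv hR hv
  rintro q ⟨hfreq, N, hN⟩
  by_contra hodd
  rw [Nat.not_even_iff_odd] at hodd
  let Z := gState upd m0 p
  have hpr : ∀ n, N ≤ n → q ≤ G.pas (Z n).1 := fun n hn => (hN n hn).trans (hinv n).gPas_le
  have hev : ∀ b, (∀ q' < b, Odd q' → ¬ ∀ K, ∃ n, K ≤ n ∧ Z n ∉ Hi q') →
      ∃ K, ∀ n, K ≤ n → ∀ q' < b, Odd q' → Z n ∈ Hi q' := by
    intro b hb
    have := (Filter.eventually_all_finite (l := Filter.atTop) (Set.finite_Iio b)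
      (p := fun q' n => Odd q' → Z n ∈ Hi q')).2 fun q' hq' => by
        by_cases ho : Odd q'
        · have := hb q' hq' ho
          push Not at this
          obtain ⟨K, hK⟩ := this
          exact Filter.eventually_atTop.2 ⟨K, fun n hn _ => hK n hn⟩
        · exact Filter.Eventually.of_forall fun n h => (ho h).elim
    exact Filter.eventually_atTop.1 this
  have hex : ∃ q', q' ≤ q ∧ Odd q' ∧ ∀ K, ∃ n, K ≤ n ∧ Z n ∉ Hi q' := by
    by_contra! hcon
    obtain ⟨K, hK⟩ := hev (q + 1) fun q' hq' ho h => by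
      obtain ⟨K, hK⟩ := hcon q' (by omega) ho
      obtain ⟨n, hn, h⟩ := h K
      exact h (hK n hn)
    obtain ⟨n, hn, hq⟩ := hfreq K
    dsimp only at hq
    obtain ⟨q', hq', ho, h⟩ := hR.exists_notMem_hi (hinv n) (by rwa [hq])
    exact h (hK n hn q' (by omega) ho)
  obtain ⟨hqs, hqo, hqf⟩ := Nat.find_spec hex
  have hmin := fun q' (h : q' < Nat.find hex) => Nat.find_min hex h
  set qs := Nat.find hex
  obtain ⟨K, hK⟩ := hev qs fun q' hq' ho h => hmin q' hq' ⟨by omega, ho, h⟩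
  have hlt : ∀ n, max N K ≤ n → (p n).IsMove → Z n ∉ Hi qs → r qs (Z (n + 1)) < r qs (Z n) := by
    intro n hn hm hH
    have h1 := hpr (n + 1) (by omega)
    have h2 := hN n (by omega)
    have := hR.lt_of_isMove (hinv n) (hp.edge n) (hp.move n) hm hqo (hqs.trans h2) (hqs.trans h1)
      hH (hK n (by omega))
    rwa [← gState_succ] at this
  have hle : ∀ n, max N K ≤ n → r qs (Z (n + 1)) ≤ r qs (Z n) := by
    intro n hn
    by_cases hm : (p n).IsMove
    · by_cases hH : Z n ∈ Hi qs
      · exact hR.le qs hqo _ (hinv n).2.1 (hqs.trans (hpr n (by omega))) hH _ (hp.memNxt hR hv hm)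
          (hqs.trans (hpr (n + 1) (by omega)))
      · exact (hlt n hn hm hH).le
    · obtain ⟨h1, h2⟩ := (hR.step (hinv n) (hp.edge n) (hp.move n)).2.2 hm
      have : Z (n + 1) = Z n := (gState_succ p n).trans (Prod.ext h1 h2)
      rw [this]
  have hanti : ∀ a b, max N K ≤ a → a ≤ b → r qs (Z b) ≤ r qs (Z a) := by
    intro a b ha hab
    induction b, hab using Nat.le_induction with
    | base => exact le_rfl
    | succ b hb ih => exact (hle b (by omega)).trans ih
  have hdesc : ∀ c n, max N K ≤ n → r qs (Z n) = c → False := by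
    intro c
    induction c using Nat.strong_induction_on with
    | _ c ih =>
      rintro n hn rfl
      obtain ⟨a, ha, haH⟩ := hqf n
      obtain ⟨b, hab, hb, hZ⟩ := hp.exists_isMove a
      have hZb : Z b = Z a := hZ b hab le_rfl
      exact ih _ ((hlt b (by omega) hb (hZb ▸ haH)).trans_le (hanti n b hn (by omega))) (b + 1)
        (by omega) rfl
  exact hdesc _ _ le_rfl rfl

/-- A finite-memory winning strategy yields a sure-winning strategy in the reduced game. -/
theorem SASGame.FinWins0.gSureWin (hfin : {y : GVert V | GValid G y}.Finite)
    (h : G.FinWins0 v) : GSureWin G (GLift G v) := by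
  classical
  obtain ⟨σ, ⟨M, hM, m0, upd, out₀, hσ₀⟩, hw⟩ := h
  choose dflt hdflt using G.succ_nonempty
  obtain ⟨out, hout, hσ⟩ : ∃ out : M → V → V, (∀ m v, v ∈ G.V0 → G.E v (out m v)) ∧
      ∀ h v, σ h v = out (h.foldl upd m0) v := by
    refine ⟨fun m v => if v ∈ G.V0 ∧ ¬ G.E v (out₀ m v) then dflt v else out₀ m v,
      fun m v hv => ?_, fun h v => ?_⟩
    · dsimp only
      split_ifs with h
      · exact hdflt v
      · exact by_contra fun hE => h ⟨hv, hE⟩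
    · dsimp only
      rw [if_neg, hσ₀]
      rintro ⟨hv, hE⟩
      exact hE (hσ₀ h v ▸ hw.1 h v hv)
  obtain ⟨r, Hi, wst, hR⟩ := exists_memRanking (upd := upd) (U := memReach G upd out m0 v) hout
    (fun z hz t => memReach_step hz) fun q hq C hC d => hw.not_isTrapping hσ hq hC d
  have hv : (v, m0) ∈ memReach G upd out m0 v := memReach_base v
  refine ⟨fun H y => gMove G out Hi wst (H.foldl (gUpd upd) m0) y,
    fun H y h0 hy => hR.gEdge_gMove _ h0 hy, fun p h0 hE hmove => ?_⟩
  have hp : GPlay G upd out m0 v Hi wst p := ⟨h0, hE, hmove⟩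
  have hrange : (Set.range p).Finite := by
    refine hfin.subset ?_
    rintro _ ⟨n, rfl⟩
    exact (hp.inv hR hv n).1
  exact ⟨(mem_parityWin_iff hrange).2 (hp.evenInf_gPs hR hv hσ hw.2.1),
    (mem_parityWin_iff hrange).2 (hp.evenInf_gPas hR hv)⟩

end OfFiniteMemory

/-- the reduced two-player game `G'` has `O(n · d_as)`
configurations, its winning condition is the intersection of the two parity
conditions induced by `p'_s` and `p'_as` (as in `GSureWin`), and Player 0 wins
the SAS game `G` from `v` with finite memory iff she sure-wins `G'` from the
configuration corresponding to `v`. -/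
theorem sas_finite_memory_reduction (G : SASGame V) (ds das : ℕ)
    (hds : Even ds) (hdas : Even das)
    (hs : ∀ v, G.ps v ≤ ds) (has : ∀ v, G.pas v ≤ das) :
    ({x : GVert V | GValid G x}).Finite ∧
    Nat.card {x : GVert V // GValid G x} ≤ Fintype.card V * (2 * das + 4) ∧
    (∀ v ∈ G.V0 ∪ G.V1, (G.FinWins0 v ↔ GSureWin G (GVert.base v))) ∧
    (∀ v ∈ G.Vp, (G.FinWins0 v ↔ GSureWin G (GVert.bar v))) := by
  have hfin := finite_gValid G has
  refine ⟨hfin, card_gValid_le G has, fun v hv => ?_, fun v hv => ?_⟩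
  · have hp : v ∉ G.Vp := by
      rcases hv with h | h
      · exact Set.disjoint_left.1 G.disj0p h
      · exact Set.disjoint_left.1 G.disj1p h
    rw [← gLift_of_notMem hp]
    exact ⟨fun h => h.gSureWin hfin, fun h => h.finWins0 hfin⟩
  · rw [← gLift_of_mem hv]
    exact ⟨fun h => h.gSureWin hfin, fun h => h.finWins0 hfin⟩
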